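/- Let Ω ⊂ ℝ be an open bounded interval and let f satisfy hypothesis (F). Let S denote the solution operator sending data (u₀,u_{0t},Θ₀) ∈ W₀^{1,2}(Ω)×L²(Ω)×L²(Ω) with Θ₀ ≥ 0 a.e. to the unique global weak solution of system (P) in the regularity class (R). If sequences (u₀^{(k)}) ⊂ W₀^{1,2}(Ω), (u_{0t}^{(k)}) ⊂ L²(Ω), (Θ₀^{(k)}) ⊂ L²(Ω) with Θ₀^{(k)} ≥ 0 a.e. satisfy u₀^{(k)} → u₀ in W₀^{1,2}(Ω), u_{0t}^{(k)} → u_{0t} in L²(Ω) and Θ₀^{(k)} → Θ₀ in L²(Ω) as k → ∞, then the solutions (u^{(k)},Θ^{(k)}) := S(u₀^{(k)},u_{0t}^{(k)},Θ₀^{(k)}) and (u,Θ) := S(u₀,u_{0t},Θ₀) satisfy u^{(k)} → u in C⁰_loc([0,∞);W₀^{1,2}(Ω)), u_t^{(k)} → u_t in C⁰_loc([0,∞);L²(Ω)), and Θ^{(k)} → Θ in C⁰_loc([0,∞);L²(Ω)) ∩ L²_loc([0,∞);W^{1,2}(Ω)). -/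

import Mathlib

open MeasureTheory Filter Set Function

noncomputable section

/-- Integral over `Ω = (a,b)`. -/
def intOm (a b : ℝ) (g : ℝ → ℝ) : ℝ := ∫ x in Ioo a b, g x

/-- Double integral over `Ω × (0,T)`. -/
def intOmT (a b T : ℝ) (F : ℝ → ℝ → ℝ) : ℝ :=
  ∫ p in (Ioo a b) ×ˢ (Ioo 0 T), F p.1 p.2

/-- Squared `L²(Ω)` integral of `g`. -/
def sqOm (a b : ℝ) (g : ℝ → ℝ) : ℝ := ∫ x in Ioo a b, (g x) ^ 2

/-- `L²(Ω)` norm. -/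
def nrmL2 (a b : ℝ) (g : ℝ → ℝ) : ℝ := (∫ x in Ioo a b, (g x) ^ 2) ^ (1 / 2 : ℝ)

/-- `L¹(Ω)` norm. -/
def nrmL1 (a b : ℝ) (g : ℝ → ℝ) : ℝ := ∫ x in Ioo a b, |g x|

/-- Membership in `L²(Ω)`. -/
def MemL2 (a b : ℝ) (g : ℝ → ℝ) : Prop :=
  AEStronglyMeasurable g (volume.restrict (Ioo a b)) ∧
    IntegrableOn (fun x => (g x) ^ 2) (Ioo a b)

/-- Zero-trace weak derivative on `(a,b)`: `g ∈ W₀^{1,1}(a,b)` with weak derivative `g'`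
(integration by parts against all smooth test functions, with no boundary terms). -/
def WeakDerivZ (a b : ℝ) (g g' : ℝ → ℝ) : Prop :=
  ∀ ψ : ℝ → ℝ, ContDiff ℝ (⊤ : ℕ∞) ψ →
    ∫ x in Ioo a b, g x * deriv ψ x = - ∫ x in Ioo a b, g' x * ψ x

/-- Interior weak derivative on `(a,b)`: `g ∈ W^{1,1}(a,b)` with weak derivative `g'`. -/
def WeakDerivI (a b : ℝ) (g g' : ℝ → ℝ) : Prop :=
  ∀ ψ : ℝ → ℝ, ContDiff ℝ (⊤ : ℕ∞) ψ → tsupport ψ ⊆ Ioo a b →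
    ∫ x in Ioo a b, g x * deriv ψ x = - ∫ x in Ioo a b, g' x * ψ x

/-- Hypothesis (F) on the nonlinearity `f`, where `f'`, `f''` denote its first and second
derivatives on `[0,∞)`: `f ∈ C²([0,∞))`, `f(0)=0`, `f' > 0` on `[0,∞)`,
and `f' ∈ W^{1,∞}((0,∞))` (i.e. `f'` and `f''` are bounded). -/
structure HypF (f f' f'' : ℝ → ℝ) : Prop where
  hasDeriv₁ : ∀ x ∈ Ici (0 : ℝ), HasDerivWithinAt f (f' x) (Ici 0) x
  hasDeriv₂ : ∀ x ∈ Ici (0 : ℝ), HasDerivWithinAt f' (f'' x) (Ici 0) x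
  cont₂ : ContinuousOn f'' (Ici 0)
  zero : f 0 = 0
  pos : ∀ x ∈ Ici (0 : ℝ), 0 < f' x
  bdd : ∃ M : ℝ, ∀ x ∈ Ici (0 : ℝ), |f' x| ≤ M ∧ |f'' x| ≤ M

/-- Partial derivative in the first (spatial) variable. -/
def pdx (w : ℝ → ℝ → ℝ) : ℝ → ℝ → ℝ := fun x t => deriv (fun y => w y t) x

/-- Partial derivative in the second (time) variable. -/
def pdt (w : ℝ → ℝ → ℝ) : ℝ → ℝ → ℝ := fun x t => deriv (fun s => w x s) t

/-- Test functions in `C₀^∞(Ω × [0,T))`. -/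
structure TestU (a b T : ℝ) (φ : ℝ → ℝ → ℝ) : Prop where
  smooth : ContDiff ℝ (⊤ : ℕ∞) (uncurry φ)
  suppx : ∃ K : Set ℝ, IsCompact K ∧ K ⊆ Ioo a b ∧ ∀ x t, x ∉ K → φ x t = 0
  suppt : ∃ T' : ℝ, T' < T ∧ ∀ x t, T' ≤ t → φ x t = 0

/-- Test functions in `C^∞(Ω̄ × [0,T))`, compactly supported in time. -/
structure TestT (T : ℝ) (φ : ℝ → ℝ → ℝ) : Prop where
  smooth : ContDiff ℝ (⊤ : ℕ∞) (uncurry φ)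
  suppt : ∃ T' : ℝ, T' < T ∧ ∀ x t, T' ≤ t → φ x t = 0

/-- Test functions in `C₀^∞(Ω × (0,T))`. -/
structure TestInt (a b T : ℝ) (φ : ℝ → ℝ → ℝ) : Prop where
  smooth : ContDiff ℝ (⊤ : ℕ∞) (uncurry φ)
  suppx : ∃ K : Set ℝ, IsCompact K ∧ K ⊆ Ioo a b ∧ ∀ x t, x ∉ K → φ x t = 0
  supptime : ∃ K : Set ℝ, IsCompact K ∧ K ⊆ Ioo 0 T ∧ ∀ x t, t ∉ K → φ x t = 0

/-- Definition (W): weak solution of (P) on `Ω × (0,T)`.  Here `ut`, `ux`, `Θx` denote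
the weak derivatives of `u` (in time and space) and of `Θ` (in space). -/
structure IsWeakSol (a b T : ℝ) (f f' : ℝ → ℝ) (u0 u0t Θ0 : ℝ → ℝ)
    (u ut ux Θ Θx : ℝ → ℝ → ℝ) : Prop where
  u_sliceL1 : ∀ t ∈ Icc 0 T, IntegrableOn (fun x => u x t) (Ioo a b)
  u_contL1 : ∀ t₀ ∈ Icc 0 T,
    Tendsto (fun t => ∫ x in Ioo a b, |u x t - u x t₀|) (nhdsWithin t₀ (Icc 0 T)) (nhds 0)
  u_int : IntegrableOn (fun p : ℝ × ℝ => u p.1 p.2) ((Ioo a b) ×ˢ (Ioo 0 T))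
  ux_int : IntegrableOn (fun p : ℝ × ℝ => ux p.1 p.2) ((Ioo a b) ×ˢ (Ioo 0 T))
  u_W0 : ∀ᵐ t ∂volume.restrict (Ioo 0 T), WeakDerivZ a b (fun x => u x t) (fun x => ux x t)
  Θ_int : IntegrableOn (fun p : ℝ × ℝ => Θ p.1 p.2) ((Ioo a b) ×ˢ (Ioo 0 T))
  Θx_int : IntegrableOn (fun p : ℝ × ℝ => Θx p.1 p.2) ((Ioo a b) ×ˢ (Ioo 0 T))
  Θ_W : ∀ᵐ t ∂volume.restrict (Ioo 0 T), WeakDerivI a b (fun x => Θ x t) (fun x => Θx x t)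
  Θ_nonneg : ∀ᵐ p ∂volume.restrict ((Ioo a b) ×ˢ (Ioo 0 T)), 0 ≤ Θ p.1 p.2
  ut_weak : ∀ φ : ℝ → ℝ → ℝ, TestInt a b T φ →
    intOmT a b T (fun x t => u x t * pdt φ x t) = - intOmT a b T (fun x t => ut x t * φ x t)
  ut_int : IntegrableOn (fun p : ℝ × ℝ => ut p.1 p.2) ((Ioo a b) ×ˢ (Ioo 0 T))
  g1_int : IntegrableOn (fun p : ℝ × ℝ => f' (Θ p.1 p.2) * Θx p.1 p.2)
    ((Ioo a b) ×ˢ (Ioo 0 T))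
  g2_int : IntegrableOn (fun p : ℝ × ℝ => f' (Θ p.1 p.2) * Θx p.1 p.2 * ut p.1 p.2)
    ((Ioo a b) ×ˢ (Ioo 0 T))
  g3_int : IntegrableOn (fun p : ℝ × ℝ => f (Θ p.1 p.2) * ut p.1 p.2)
    ((Ioo a b) ×ˢ (Ioo 0 T))
  weak_u : ∀ φ : ℝ → ℝ → ℝ, TestU a b T φ →
    intOmT a b T (fun x t => u x t * pdt (pdt φ) x t)
        - intOm a b (fun x => u0t x * φ x 0) + intOm a b (fun x => u0 x * pdt φ x 0)
      = - intOmT a b T (fun x t => ux x t * pdx φ x t)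
        - intOmT a b T (fun x t => f' (Θ x t) * Θx x t * φ x t)
  weak_Θ : ∀ φ : ℝ → ℝ → ℝ, TestT T φ →
    - intOmT a b T (fun x t => Θ x t * pdt φ x t) - intOm a b (fun x => Θ0 x * φ x 0)
      = - intOmT a b T (fun x t => Θx x t * pdx φ x t)
        + intOmT a b T (fun x t => f' (Θ x t) * Θx x t * ut x t * φ x t)
        + intOmT a b T (fun x t => f (Θ x t) * ut x t * pdx φ x t)

/-- Continuity of `t ↦ w(·,t)` as a map `J → L²(Ω)` (with slices in `L²(Ω)`). -/
def ContL2 (a b : ℝ) (J : Set ℝ) (w : ℝ → ℝ → ℝ) : Prop :=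
  (∀ t ∈ J, MemL2 a b (fun x => w x t)) ∧
    ∀ t₀ ∈ J, Tendsto (fun t => ∫ x in Ioo a b, (w x t - w x t₀) ^ 2)
      (nhdsWithin t₀ J) (nhds 0)

/-- The regularity class (R_T):  `u ∈ C⁰([0,T];W₀^{1,2})`, `u_t ∈ C⁰([0,T];L²)`,
`Θ ∈ C⁰([0,T];L²) ∩ L²((0,T);W^{1,2})`. -/
structure RegT (a b T : ℝ) (u ut ux Θ Θx : ℝ → ℝ → ℝ) : Prop where
  u_cont : ContL2 a b (Icc 0 T) u
  ux_cont : ContL2 a b (Icc 0 T) ux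
  u_W0 : ∀ t ∈ Icc (0 : ℝ) T, WeakDerivZ a b (fun x => u x t) (fun x => ux x t)
  ut_cont : ContL2 a b (Icc 0 T) ut
  Θ_cont : ContL2 a b (Icc 0 T) Θ
  Θ_sq_int : IntegrableOn (fun p : ℝ × ℝ => (Θ p.1 p.2) ^ 2) ((Ioo a b) ×ˢ (Ioo 0 T))
  Θx_sq_int : IntegrableOn (fun p : ℝ × ℝ => (Θx p.1 p.2) ^ 2) ((Ioo a b) ×ˢ (Ioo 0 T))

/-- Data hypothesis (I), with `u0x` the weak derivative of `u0 ∈ W₀^{1,2}(Ω)`. -/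
structure DataI (a b : ℝ) (u0 u0x u0t Θ0 : ℝ → ℝ) : Prop where
  u0_L2 : MemL2 a b u0
  u0x_L2 : MemL2 a b u0x
  u0_W0 : WeakDerivZ a b u0 u0x
  u0t_L2 : MemL2 a b u0t
  Θ0_L2 : MemL2 a b Θ0
  Θ0_nonneg : ∀ᵐ x ∂volume.restrict (Ioo a b), 0 ≤ Θ0 x

/-- Smooth-data hypothesis (I∞). -/
structure SmoothData (a b : ℝ) (v0 u0 Θ0 : ℝ → ℝ) : Prop where
  v0_smooth : ContDiff ℝ (⊤ : ℕ∞) v0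
  v0_supp : ∃ K : Set ℝ, IsCompact K ∧ K ⊆ Ioo a b ∧ ∀ x, x ∉ K → v0 x = 0
  u0_smooth : ContDiff ℝ (⊤ : ℕ∞) u0
  u0_supp : ∃ K : Set ℝ, IsCompact K ∧ K ⊆ Ioo a b ∧ ∀ x, x ∉ K → u0 x = 0
  Θ0_smooth : ContDiff ℝ (⊤ : ℕ∞) Θ0
  Θ0_pos : ∀ x ∈ Icc a b, 0 < Θ0 x
  Θ0x_supp : ∃ K : Set ℝ, IsCompact K ∧ K ⊆ Ioo a b ∧ ∀ x, x ∉ K → deriv Θ0 x = 0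

/-- Classical solution of the regularized problem (P_ε), of class
`C^{4,1} × C^{2,1} × C^{2,1}(Ω̄ × [0,∞))`, with positive temperature. -/
structure IsClassicalSolEps (a b : ℝ) (f : ℝ → ℝ) (ε : ℝ) (v0 u0 Θ0 : ℝ → ℝ)
    (v u Θ : ℝ → ℝ → ℝ) : Prop where
  diffx_v : ∀ k < 4, ∀ x ∈ Icc a b, ∀ t ∈ Ici (0 : ℝ),
    DifferentiableAt ℝ (fun y => pdx^[k] v y t) x
  difft_v : ∀ x ∈ Icc a b, ∀ t ∈ Ici (0 : ℝ), DifferentiableAt ℝ (fun s => v x s) t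
  cont_v : ∀ k ≤ 4, ContinuousOn (uncurry (pdx^[k] v)) ((Icc a b) ×ˢ (Ici 0))
  contt_v : ContinuousOn (uncurry (pdt v)) ((Icc a b) ×ˢ (Ici 0))
  diffx_u : ∀ k < 2, ∀ x ∈ Icc a b, ∀ t ∈ Ici (0 : ℝ),
    DifferentiableAt ℝ (fun y => pdx^[k] u y t) x
  difft_u : ∀ x ∈ Icc a b, ∀ t ∈ Ici (0 : ℝ), DifferentiableAt ℝ (fun s => u x s) t
  cont_u : ∀ k ≤ 2, ContinuousOn (uncurry (pdx^[k] u)) ((Icc a b) ×ˢ (Ici 0))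
  contt_u : ContinuousOn (uncurry (pdt u)) ((Icc a b) ×ˢ (Ici 0))
  diffx_Θ : ∀ k < 2, ∀ x ∈ Icc a b, ∀ t ∈ Ici (0 : ℝ),
    DifferentiableAt ℝ (fun y => pdx^[k] Θ y t) x
  difft_Θ : ∀ x ∈ Icc a b, ∀ t ∈ Ici (0 : ℝ), DifferentiableAt ℝ (fun s => Θ x s) t
  cont_Θ : ∀ k ≤ 2, ContinuousOn (uncurry (pdx^[k] Θ)) ((Icc a b) ×ˢ (Ici 0))
  contt_Θ : ContinuousOn (uncurry (pdt Θ)) ((Icc a b) ×ˢ (Ici 0))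
  Θ_pos : ∀ x ∈ Icc a b, ∀ t ∈ Ici (0 : ℝ), 0 < Θ x t
  eq_v : ∀ x ∈ Ioo a b, ∀ t ∈ Ioi (0 : ℝ),
    pdt v x t = -ε * pdx^[4] v x t + pdx^[2] u x t - pdx (fun y s => f (Θ y s)) x t
  eq_u : ∀ x ∈ Ioo a b, ∀ t ∈ Ioi (0 : ℝ), pdt u x t = ε * pdx^[2] u x t + v x t
  eq_Θ : ∀ x ∈ Ioo a b, ∀ t ∈ Ioi (0 : ℝ),
    pdt Θ x t = pdx^[2] Θ x t - f (Θ x t) * pdx v x t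
  bc_v : ∀ t ∈ Ioi (0 : ℝ),
    v a t = 0 ∧ v b t = 0 ∧ pdx^[2] v a t = 0 ∧ pdx^[2] v b t = 0
  bc_u : ∀ t ∈ Ioi (0 : ℝ), u a t = 0 ∧ u b t = 0
  bc_Θ : ∀ t ∈ Ioi (0 : ℝ), pdx Θ a t = 0 ∧ pdx Θ b t = 0
  init : ∀ x ∈ Icc a b, v x 0 = v0 x ∧ u x 0 = u0 x ∧ Θ x 0 = Θ0 x

/-- Weak convergence in `L²_loc(Ω̄ × [0,∞))`. -/
def WkL2loc (a b : ℝ) (wj : ℕ → ℝ → ℝ → ℝ) (w : ℝ → ℝ → ℝ) : Prop :=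
  ∀ T > (0 : ℝ), ∀ ψ : ℝ → ℝ → ℝ,
    AEStronglyMeasurable (fun p : ℝ × ℝ => ψ p.1 p.2)
      (volume.restrict ((Icc a b) ×ˢ (Icc 0 T))) →
    IntegrableOn (fun p : ℝ × ℝ => (ψ p.1 p.2) ^ 2) ((Icc a b) ×ˢ (Icc 0 T)) →
    Tendsto (fun j => ∫ p in (Icc a b) ×ˢ (Icc 0 T), wj j p.1 p.2 * ψ p.1 p.2) atTop
      (nhds (∫ p in (Icc a b) ×ˢ (Icc 0 T), w p.1 p.2 * ψ p.1 p.2))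

/-- A primitive of an integrable function is absolutely continuous. -/
lemma absolutelyContinuousOnInterval_primitive {a b : ℝ} {r : ℝ → ℝ}
    (hr : IntervalIntegrable r volume a b) (c : ℝ) :
    AbsolutelyContinuousOnInterval (fun t => c + ∫ s in a..t, r s) a b := by
  have h1 : AbsolutelyContinuousOnInterval (fun _ : ℝ => c) a b :=
    (contDiff_const.contDiffOn).absolutelyContinuousOnInterval
  exact h1.fun_add (hr.absolutelyContinuousOnInterval_intervalIntegral left_mem_uIcc)

lemma ae_hasDerivAt_primitive {a b : ℝ} {r : ℝ → ℝ}
    (hr : IntervalIntegrable r volume a b) (c : ℝ) :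
    ∀ᵐ t, t ∈ uIcc a b → HasDerivAt (fun t => c + ∫ s in a..t, r s) (r t) t := by
  filter_upwards [hr.ae_hasDerivAt_integral] with t ht hm
  exact (ht hm a left_mem_uIcc).const_add c

lemma primitive_mul_primitive_sub {a b : ℝ} {r q : ℝ → ℝ}
    (hr : IntervalIntegrable r volume a b) (hq : IntervalIntegrable q volume a b) (c d : ℝ) :
    (c + ∫ s in a..b, r s) * (d + ∫ s in a..b, q s) - c * d =
      ∫ t in a..b, (r t * (d + ∫ s in a..t, q s) + (c + ∫ s in a..t, r s) * q t) := by
  have h := (absolutelyContinuousOnInterval_primitive hr c).integral_deriv_mul_eq_sub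
    (absolutelyContinuousOnInterval_primitive hq d)
  simp only [intervalIntegral.integral_same, add_zero] at h
  rw [← h]
  apply intervalIntegral.integral_congr_ae
  filter_upwards [ae_hasDerivAt_primitive hr c, ae_hasDerivAt_primitive hq d] with t h1 h2 ht
  rw [(h1 (uIoc_subset_uIcc ht)).deriv, (h2 (uIoc_subset_uIcc ht)).deriv]

lemma primitive_sq_sub {a b : ℝ} {r : ℝ → ℝ} (hr : IntervalIntegrable r volume a b) (c : ℝ) :
    (c + ∫ s in a..b, r s) ^ 2 - c ^ 2 = ∫ t in a..b, 2 * ((c + ∫ s in a..t, r s) * r t) := by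
  have h := primitive_mul_primitive_sub hr hr c c
  rw [pow_two, pow_two, h]
  congr 1; ext t; ring

/-- Integration by parts of a primitive against a smooth function. -/
lemma integral_primitive_mul_deriv {a b : ℝ} {r χ : ℝ → ℝ}
    (hr : IntervalIntegrable r volume a b) (c : ℝ) (hχ : ContDiff ℝ (⊤ : ℕ∞) χ) :
    ∫ t in a..b, (c + ∫ s in a..t, r s) * deriv χ t =
      (c + ∫ s in a..b, r s) * χ b - c * χ a - ∫ t in a..b, r t * χ t := by
  have h := (absolutelyContinuousOnInterval_primitive hr c).integral_mul_deriv_eq_deriv_mul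
    ((hχ.of_le (by exact_mod_cast le_top)).contDiffOn.absolutelyContinuousOnInterval
      (a := a) (b := b))
  simp only [intervalIntegral.integral_same, add_zero] at h
  rw [h]
  congr 1
  apply intervalIntegral.integral_congr_ae
  filter_upwards [ae_hasDerivAt_primitive hr c] with t h1 ht
  rw [(h1 (uIoc_subset_uIcc ht)).deriv]

lemma exp_neg_primitive {a b : ℝ} (hab : a ≤ b) {κ : ℝ → ℝ} (hκ : IntervalIntegrable κ volume a b)
    (hκ0 : ∀ᵐ s ∂volume.restrict (Ioc a b), 0 ≤ κ s) :
    IntervalIntegrable (fun s => - κ s * Real.exp (-∫ x in a..s, κ x)) volume a b ∧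
    ∀ t ∈ Icc a b, Real.exp (-∫ s in a..t, κ s) =
      1 + ∫ s in a..t, - κ s * Real.exp (-∫ x in a..s, κ x) := by
  have hac0 := absolutelyContinuousOnInterval_primitive hκ 0
  simp only [zero_add] at hac0
  have hK0 : ∀ t ∈ uIcc a b, 0 ≤ ∫ s in a..t, κ s := by
    intro t ht
    rw [uIcc_of_le hab] at ht
    rw [intervalIntegral.integral_of_le ht.1]
    exact integral_nonneg_of_ae (ae_mono (Measure.restrict_mono (Ioc_subset_Ioc_right ht.2) le_rfl) hκ0)
  have hac : AbsolutelyContinuousOnInterval (fun t => Real.exp (-∫ s in a..t, κ s)) a b := by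
    rw [absolutelyContinuousOnInterval_iff] at hac0 ⊢
    intro ε hε
    obtain ⟨δ, hδ, H⟩ := hac0 ε hε
    refine ⟨δ, hδ, fun E hE hlt => lt_of_le_of_lt (Finset.sum_le_sum fun i hi => ?_) (H E hE hlt)⟩
    have h1 := hK0 _ (hE.1 i hi).1
    have h2 := hK0 _ (hE.1 i hi).2
    generalize (∫ s in a..(E.2 i).1, κ s) = p at *
    generalize (∫ s in a..(E.2 i).2, κ s) = q at *
    rw [Real.dist_eq, Real.dist_eq]
    have key : ∀ p q : ℝ, 0 ≤ p → p ≤ q → Real.exp (-p) - Real.exp (-q) ≤ q - p := by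
      intro p q hp hpq
      have e1 : Real.exp (-q) = Real.exp (-p) * Real.exp (p - q) := by rw [← Real.exp_add]; ring_nf
      have e2 := Real.add_one_le_exp (p - q)
      have e3 : Real.exp (-p) ≤ 1 := Real.exp_le_one_iff.mpr (by linarith)
      have e4 := Real.exp_pos (-p)
      rw [e1]
      nlinarith
    rcases le_total p q with hpq | hpq
    · have := key p q h1 hpq
      have h3 : Real.exp (-q) ≤ Real.exp (-p) := Real.exp_le_exp.mpr (by linarith)
      rw [abs_of_nonneg (by linarith), abs_of_nonpos (by linarith)]; linarith
    · have := key q p h2 hpq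
      have h3 : Real.exp (-p) ≤ Real.exp (-q) := Real.exp_le_exp.mpr (by linarith)
      rw [abs_of_nonpos (by linarith), abs_of_nonneg (by linarith)]; linarith
  refine ⟨hκ.neg.mul_continuousOn hac.continuousOn, ?_⟩
  intro t ht
  have hsub : uIcc a t ⊆ uIcc a b := by
    rw [uIcc_of_le ht.1, uIcc_of_le hab]; exact Icc_subset_Icc_right ht.2
  have h := (hac.mono hsub).integral_deriv_eq_sub
  simp only [intervalIntegral.integral_same, neg_zero, Real.exp_zero] at h
  have h2 : ∫ s in a..t, deriv (fun t => Real.exp (-∫ s in a..t, κ s)) s =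
      ∫ s in a..t, - κ s * Real.exp (-∫ x in a..s, κ x) := by
    apply intervalIntegral.integral_congr_ae
    filter_upwards [hκ.ae_hasDerivAt_integral] with s hs hm
    have hd : HasDerivAt (fun t => Real.exp (-∫ s in a..t, κ s))
        (Real.exp (-∫ x in a..s, κ x) * -κ s) s :=
      (hs (hsub (uIoc_subset_uIcc hm)) a left_mem_uIcc).neg.exp
    rw [hd.deriv, mul_comm]
  rw [← h2, h]; ring

/-- Gronwall's inequality in integral form with an integrable coefficient. -/
lemma gronwall_integral {T : ℝ} {κ Y : ℝ → ℝ} {y : ℝ} (hκ : IntervalIntegrable κ volume 0 T)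
    (hκ0 : ∀ s, 0 ≤ κ s) (hY : ContinuousOn Y (Icc 0 T)) {t : ℝ} (ht : t ∈ Icc 0 T)
    (h : ∀ s ∈ Icc 0 t, Y s ≤ y + ∫ x in (0 : ℝ)..s, κ x * Y x) :
    y + ∫ x in (0 : ℝ)..t, κ x * Y x ≤ y * Real.exp (∫ s in (0 : ℝ)..t, κ s) := by
  have hsub : uIcc 0 t ⊆ uIcc 0 T := by
    rw [uIcc_of_le ht.1, uIcc_of_le (ht.1.trans ht.2)]; exact Icc_subset_Icc_right ht.2
  have hκt := hκ.mono_set hsub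
  have hκY : IntervalIntegrable (fun x => κ x * Y x) volume 0 t := by
    apply hκt.mul_continuousOn
    rw [uIcc_of_le ht.1]; exact hY.mono (Icc_subset_Icc_right ht.2)
  obtain ⟨hi, he⟩ := exp_neg_primitive ht.1 hκt (ae_of_all _ hκ0)
  have hp := primitive_mul_primitive_sub hκY hi y 1
  rw [← he t ⟨ht.1, le_rfl⟩] at hp
  have hle : (y + ∫ x in (0 : ℝ)..t, κ x * Y x) * Real.exp (-∫ s in (0 : ℝ)..t, κ s) ≤ y := by
    have : ∫ s in (0 : ℝ)..t, (κ s * Y s * (1 + ∫ x in (0 : ℝ)..s, - κ x * Real.exp (-∫ x in (0 : ℝ)..x, κ x)) +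
        (y + ∫ x in (0 : ℝ)..s, κ x * Y x) * (- κ s * Real.exp (-∫ x in (0 : ℝ)..s, κ x))) ≤ 0 := by
      rw [intervalIntegral.integral_of_le ht.1]
      apply setIntegral_nonpos measurableSet_Ioc
      intro s hs
      have hs' : s ∈ Icc 0 t := ⟨hs.1.le, hs.2⟩
      rw [← he s hs']
      have e := Real.exp_pos (-∫ x in (0 : ℝ)..s, κ x)
      have h1 := h s hs'
      have : 0 ≤ κ s * Real.exp (-∫ x in (0 : ℝ)..s, κ x) * ((y + ∫ x in (0 : ℝ)..s, κ x * Y x) - Y s) :=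
        mul_nonneg (mul_nonneg (hκ0 s) e.le) (by linarith)
      linarith
    linarith
  rw [Real.exp_neg, ← div_eq_mul_inv, div_le_iff₀ (Real.exp_pos _)] at hle
  exact hle

lemma MeasureTheory.IntegrableOn.mul_continuous_of_Ioo {a b : ℝ} {p w : ℝ → ℝ}
    (hp : IntegrableOn p (Ioo a b)) (hw : Continuous w) :
    IntegrableOn (fun x => p x * w x) (Ioo a b) := by
  obtain ⟨C, hC⟩ := isCompact_Icc.exists_bound_of_continuousOn (hw.continuousOn (s := Icc a b))
  refine hp.mul_bdd (c := C) hw.aestronglyMeasurable ?_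
  exact (ae_restrict_mem measurableSet_Ioo).mono fun x hx => hC x (Ioo_subset_Icc_self hx)

/-- The du Bois-Reymond lemma: a function with an integrable weak derivative is a primitive. -/
lemma WeakDerivI.exists_primitive {a b : ℝ} (hab : a < b) {g g' : ℝ → ℝ}
    (hg : IntegrableOn g (Ioo a b)) (hg' : IntegrableOn g' (Ioo a b)) (h : WeakDerivI a b g g') :
    ∃ c, ∀ᵐ x ∂volume.restrict (Ioo a b), g x = c + ∫ s in a..x, g' s := by
  have hg'i : IntervalIntegrable g' volume a b := by
    rw [intervalIntegrable_iff_integrableOn_Ioo_of_le hab.le]; exact hg'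
  have hRc : ContinuousOn (fun x => ∫ s in a..x, g' s) (Icc a b) := by
    have := (absolutelyContinuousOnInterval_primitive hg'i 0).continuousOn
    simpa [uIcc_of_le hab.le] using this
  have hRi : IntegrableOn (fun x => ∫ s in a..x, g' s) (Ioo a b) :=
    (hRc.integrableOn_Icc).mono_set Ioo_subset_Icc_self
  set z : ℝ → ℝ := fun x => g x - ∫ s in a..x, g' s with hz
  have hzi : IntegrableOn z (Ioo a b) := hg.sub hRi
  let B : ContDiffBump ((a + b) / 2) := ⟨(b - a) / 8, (b - a) / 4, by linarith, by linarith⟩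
  set η₀ : ℝ → ℝ := B.normed volume with hη₀
  have hη₀s : ContDiff ℝ (⊤ : ℕ∞) η₀ := B.contDiff_normed
  have hη₀t : tsupport η₀ ⊆ Icc ((a + b) / 2 - (b - a) / 4) ((a + b) / 2 + (b - a) / 4) := by
    rw [hη₀, B.tsupport_normed_eq, Real.closedBall_eq_Icc]
  have hη₀1 : ∫ x, η₀ x = 1 := B.integral_normed
  set c := ∫ x in Ioo a b, z x * η₀ x with hc
  refine ⟨c, ?_⟩
  have key : ∀ η : ℝ → ℝ, ContDiff ℝ (⊤ : ℕ∞) η → HasCompactSupport η → tsupport η ⊆ Ioo a b →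
      ∫ x, η x • (z x - c) = 0 := by
    intro η hη hηc hηt
    have hred : ∫ x, η x • (z x - c) = ∫ x in Ioo a b, (z x * η x - c * η x) := by
      rw [← setIntegral_eq_integral_of_forall_compl_eq_zero (s := Ioo a b)]
      · congr 1; ext x; simp; ring
      · intro x hx
        rw [image_eq_zero_of_notMem_tsupport fun hh => hx (hηt hh)]; simp
    have hηI : ∫ x, η x = ∫ x in Ioo a b, η x :=
      (setIntegral_eq_integral_of_forall_compl_eq_zero fun x hx =>
        image_eq_zero_of_notMem_tsupport fun hh => hx (hηt hh)).symm
    set m := ∫ x, η x with hm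
    set ζ : ℝ → ℝ := fun x => η x - m * η₀ x with hζ
    have hζs : ContDiff ℝ (⊤ : ℕ∞) ζ := hη.sub (contDiff_const.mul hη₀s)
    have hη₀c : HasCompactSupport η₀ := B.hasCompactSupport_normed
    have hζ0 : ∫ x, ζ x = 0 := by
      rw [hζ, integral_sub (hη.continuous.integrable_of_hasCompactSupport hηc)
        ((hη₀s.continuous.integrable_of_hasCompactSupport hη₀c).const_mul m), integral_const_mul,
        hη₀1]
      simp [hm]
    obtain ⟨α, β, hα, hβ, hsupp⟩ : ∃ α β, a < α ∧ β < b ∧ ∀ x, ζ x ≠ 0 → x ∈ Icc α β := by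
      set K := tsupport η ∪ Icc ((a + b) / 2 - (b - a) / 4) ((a + b) / 2 + (b - a) / 4)
      have hK : IsCompact K := IsCompact.union hηc isCompact_Icc
      have hKne : K.Nonempty := ⟨(a + b) / 2, Or.inr ⟨by linarith, by linarith⟩⟩
      have hKs : K ⊆ Ioo a b := union_subset hηt fun x hx => ⟨by linarith [hx.1], by linarith [hx.2]⟩
      obtain ⟨α, hα, hα'⟩ := hK.exists_isLeast hKne
      obtain ⟨β, hβ, hβ'⟩ := hK.exists_isGreatest hKne
      refine ⟨α, β, (hKs hα).1, (hKs hβ).2, fun x hx => ?_⟩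
      have hxK : x ∈ K := by
        by_contra hn
        apply hx
        have h1 : x ∉ tsupport η := fun hh => hn (Or.inl hh)
        have h2 : x ∉ tsupport η₀ := fun hh => hn (Or.inr (hη₀t hh))
        simp [hζ, image_eq_zero_of_notMem_tsupport h1, image_eq_zero_of_notMem_tsupport h2]
      exact ⟨hα' hxK, hβ' hxK⟩
    set ψ : ℝ → ℝ := fun x => ∫ s in a..x, ζ s with hψ
    have hψd : ∀ x, HasDerivAt ψ (ζ x) x := fun x =>
      intervalIntegral.integral_hasDerivAt_right (hζs.continuous.intervalIntegrable _ _)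
        (hζs.continuous.stronglyMeasurableAtFilter _ _) hζs.continuous.continuousAt
    have hψderiv : deriv ψ = ζ := funext fun x => (hψd x).deriv
    have hψs : ContDiff ℝ (⊤ : ℕ∞) ψ := by
      exact contDiff_infty_iff_deriv.mpr ⟨fun x => (hψd x).differentiableAt, by rw [hψderiv]; exact hζs⟩
    have hψ0 : ∀ x, x ∉ Icc α β → ψ x = 0 := by
      intro x hx
      by_cases h1 : x < α
      · apply intervalIntegral.integral_zero_ae
        refine ae_of_all _ fun s hs => ?_
        by_contra hne
        have h2 := hsupp s hne
        rcases le_total a x with h3 | h3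
        · rw [uIoc_of_le h3] at hs; linarith [hs.2, h2.1]
        · rw [uIoc_of_ge h3] at hs; linarith [hs.2, h2.1]
      · have h2 : β < x := by
          by_contra h3; exact hx ⟨not_lt.mp h1, not_lt.mp h3⟩
        rw [hψ]
        simp only
        rw [intervalIntegral.integral_eq_integral_of_support_subset, hζ0]
        intro s hs
        have := hsupp s hs
        exact ⟨by linarith [this.1], by linarith [this.2]⟩
    have hψt : tsupport ψ ⊆ Ioo a b := by
      refine (closure_minimal (fun x hx => ?_) isClosed_Icc).trans
        (fun x (hx : x ∈ Icc α β) => ⟨by linarith [hx.1], by linarith [hx.2]⟩)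
      by_contra hn
      exact hx (hψ0 x hn)
    have h1 := h ψ hψs hψt
    have h2 := integral_primitive_mul_deriv hg'i 0 hψs
    rw [hψ0 b fun hh => by linarith [hh.2], hψ0 a fun hh => by linarith [hh.1]] at h2
    simp only [intervalIntegral.integral_of_le hab.le, integral_Ioc_eq_integral_Ioo] at h2
    simp only [zero_add, mul_zero, sub_zero, zero_sub, hψderiv] at h1 h2
    have h3 : ∫ x in Ioo a b, z x * ζ x = 0 := by
      have : ∀ x, z x * ζ x = g x * ζ x - (fun x => ∫ s in a..x, g' s) x * ζ x := fun x => by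
        simp only [hz]; ring
      simp_rw [this]
      rw [integral_sub (hg.mul_continuous_of_Ioo hζs.continuous) (hRi.mul_continuous_of_Ioo hζs.continuous), h1, h2]
      ring
    have h4 : ∫ x in Ioo a b, z x * ζ x = (∫ x in Ioo a b, z x * η x) - m * c := by
      have : ∀ x, z x * ζ x = z x * η x - m * (z x * η₀ x) := fun x => by
        simp only [hζ]; ring
      simp_rw [this]
      rw [integral_sub (hzi.mul_continuous_of_Ioo hη.continuous) ((hzi.mul_continuous_of_Ioo hη₀s.continuous).const_mul m),
        integral_const_mul]
    rw [hred, integral_sub (hzi.mul_continuous_of_Ioo hη.continuous), integral_const_mul, ← hηI]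
    · linarith
    · exact ((hη.continuous.integrable_of_hasCompactSupport hηc).integrableOn).const_mul c
  have hfin := isOpen_Ioo.ae_eq_zero_of_integral_contDiff_smul_eq_zero (μ := volume)
    (f := fun x => z x - c) (U := Ioo a b)
    ((hzi.sub (integrableOn_const (by simp))).locallyIntegrableOn) key
  rw [ae_restrict_iff' measurableSet_Ioo]
  filter_upwards [hfin] with x hx hm
  have := hx hm
  simp only [hz] at this
  linarith

lemma sqOm_nonneg (a b : ℝ) (g : ℝ → ℝ) : 0 ≤ sqOm a b g :=
  integral_nonneg fun _ => sq_nonneg _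

lemma MemL2.memLp {a b : ℝ} {g : ℝ → ℝ} (h : MemL2 a b g) :
    MemLp g 2 (volume.restrict (Ioo a b)) :=
  (memLp_two_iff_integrable_sq h.1).mpr h.2

lemma MeasureTheory.MemLp.memL2 {a b : ℝ} {g : ℝ → ℝ}
    (h : MemLp g 2 (volume.restrict (Ioo a b))) : MemL2 a b g :=
  ⟨h.1, (memLp_two_iff_integrable_sq h.1).mp h⟩

lemma MemL2.sub {a b : ℝ} {g h : ℝ → ℝ} (hg : MemL2 a b g) (hh : MemL2 a b h) :
    MemL2 a b (fun x => g x - h x) :=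
  (hg.memLp.sub hh.memLp).memL2

lemma MemL2.integrableOn {a b : ℝ} {g : ℝ → ℝ} (h : MemL2 a b g) : IntegrableOn g (Ioo a b) :=
  h.memLp.integrable one_le_two

lemma Continuous.memL2 {a b : ℝ} {g : ℝ → ℝ} (h : Continuous g) : MemL2 a b g :=
  ⟨h.aestronglyMeasurable,
    (((h.pow 2).continuousOn).integrableOn_Icc).mono_set Ioo_subset_Icc_self⟩

lemma MemL2.mul_integrableOn {a b : ℝ} {g h : ℝ → ℝ} (hg : MemL2 a b g) (hh : MemL2 a b h) :
    IntegrableOn (fun x => g x * h x) (Ioo a b) :=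
  hg.memLp.integrable_mul hh.memLp

lemma MemL2.integral_abs_mul_le {a b : ℝ} {g h : ℝ → ℝ} (hg : MemL2 a b g) (hh : MemL2 a b h) :
    ∫ x in Ioo a b, |g x| * |h x| ≤ √(sqOm a b g) * √(sqOm a b h) := by
  have h2 : (ENNReal.ofReal 2) = 2 := by norm_num
  have := integral_mul_norm_le_Lp_mul_Lq (μ := volume.restrict (Ioo a b)) (f := g) (g := h)
    Real.HolderConjugate.two_two (by rw [h2]; exact hg.memLp) (by rw [h2]; exact hh.memLp)
  simpa [Real.sqrt_eq_rpow, sqOm] using this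

lemma MemL2.abs_integral_mul_le {a b : ℝ} {g h : ℝ → ℝ} (hg : MemL2 a b g) (hh : MemL2 a b h) :
    |∫ x in Ioo a b, g x * h x| ≤ √(sqOm a b g) * √(sqOm a b h) := by
  refine (abs_integral_le_integral_abs).trans ?_
  simp_rw [abs_mul]
  exact hg.integral_abs_mul_le hh

/-- Minkowski's inequality for pointwise bounds by two square-integrable functions. -/
lemma sqrt_sqOm_le_add {a b : ℝ} {g p q : ℝ → ℝ} (hp : MemL2 a b p) (hq : MemL2 a b q)
    (hg : ∀ᵐ x ∂volume.restrict (Ioo a b), |g x| ≤ |p x| + |q x|) :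
    √(sqOm a b g) ≤ √(sqOm a b p) + √(sqOm a b q) := by
  have hi : Integrable (fun x => 2 * (|p x| * |q x|)) (volume.restrict (Ioo a b)) :=
    (hp.memLp.abs.integrable_mul hq.memLp.abs).const_mul 2
  have hs : Integrable (fun x => p x ^ 2 + q x ^ 2) (volume.restrict (Ioo a b)) := hp.2.add hq.2
  have h1 : sqOm a b g ≤ sqOm a b p + sqOm a b q + 2 * ∫ x in Ioo a b, |p x| * |q x| := by
    unfold sqOm
    rw [← integral_const_mul, ← integral_add hp.2 hq.2, ← integral_add hs hi]
    apply integral_mono_of_nonneg (ae_of_all _ fun _ => sq_nonneg _) (hs.add hi)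
    filter_upwards [hg] with x hx
    have h2 : (g x) ^ 2 ≤ (|p x| + |q x|) ^ 2 := by
      rw [← sq_abs (g x)]; exact pow_le_pow_left₀ (abs_nonneg _) hx 2
    have h3 := sq_abs (p x)
    have h4 := sq_abs (q x)
    simp only [Pi.add_apply]
    nlinarith
  have h2 := hp.integral_abs_mul_le hq
  have h3 := Real.sq_sqrt (sqOm_nonneg a b p)
  have h4 := Real.sq_sqrt (sqOm_nonneg a b q)
  apply Real.sqrt_le_iff.mpr ⟨by positivity, by nlinarith⟩

lemma MemL2.sqOm_primitive_le {a b : ℝ} (hab : a < b) {g' : ℝ → ℝ} (c : ℝ) (hg' : MemL2 a b g')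
    {x : ℝ} (hx : x ∈ Icc a b) :
    (c + ∫ s in a..x, g' s) ^ 2 ≤ (b - a)⁻¹ * sqOm a b (fun x => c + ∫ s in a..x, g' s) +
      2 * √(sqOm a b (fun x => c + ∫ s in a..x, g' s)) * √(sqOm a b g') := by
  have hg'i : IntervalIntegrable g' volume a b := by
    rw [intervalIntegrable_iff_integrableOn_Ioo_of_le hab.le]; exact hg'.integrableOn
  set z : ℝ → ℝ := fun x => c + ∫ s in a..x, g' s with hz
  have hzc : ContinuousOn z (Icc a b) := by
    simpa [uIcc_of_le hab.le] using (absolutelyContinuousOnInterval_primitive hg'i c).continuousOn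
  have hz2 : MemL2 a b z :=
    ⟨(hzc.mono Ioo_subset_Icc_self).aestronglyMeasurable measurableSet_Ioo,
      ((hzc.pow 2).integrableOn_Icc).mono_set Ioo_subset_Icc_self⟩
  have hzg : IntegrableOn (fun x => z x * g' x) (Ioo a b) := hz2.mul_integrableOn hg'
  have hzgi : IntervalIntegrable (fun x => 2 * (z x * g' x)) volume a b := by
    rw [intervalIntegrable_iff_integrableOn_Ioo_of_le hab.le]; exact hzg.const_mul 2
  have hsq : ∀ y ∈ Icc a b, z y ^ 2 = c ^ 2 + ∫ t in a..y, 2 * (z t * g' t) := by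
    intro y hy
    have hsub : uIcc a y ⊆ uIcc a b := by
      rw [uIcc_of_le hy.1, uIcc_of_le hab.le]; exact Icc_subset_Icc_right hy.2
    have := primitive_sq_sub (hg'i.mono_set hsub) c
    linarith
  have hdiff : ∀ y ∈ Icc a b, z x ^ 2 ≤ z y ^ 2 + 2 * (√(sqOm a b z) * √(sqOm a b g')) := by
    intro y hy
    rw [hsq x hx, hsq y hy]
    have hsubx : uIcc a x ⊆ uIcc a b := by
      rw [uIcc_of_le hx.1, uIcc_of_le hab.le]; exact Icc_subset_Icc_right hx.2
    have hsuby : uIcc a y ⊆ uIcc a b := by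
      rw [uIcc_of_le hy.1, uIcc_of_le hab.le]; exact Icc_subset_Icc_right hy.2
    have h1 := intervalIntegral.integral_interval_sub_left (hzgi.mono_set hsubx)
      (hzgi.mono_set hsuby)
    have h2 : |∫ t in y..x, 2 * (z t * g' t)| ≤ ∫ t in Ioo a b, 2 * (|z t| * |g' t|) := by
      rw [← Real.norm_eq_abs, intervalIntegral.norm_integral_eq_norm_integral_uIoc]
      refine (norm_integral_le_integral_norm _).trans ?_
      rw [← integral_Ioc_eq_integral_Ioo]
      have : ∀ t, ‖2 * (z t * g' t)‖ = 2 * (|z t| * |g' t|) := fun t => by simp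
      simp_rw [this]
      apply setIntegral_mono_set
      · rw [integrableOn_Ioc_iff_integrableOn_Ioo]
        have : IntegrableOn (fun t => 2 * |z t * g' t|) (Ioo a b) := hzg.abs.const_mul 2
        simpa only [abs_mul] using this
      · exact ae_of_all _ fun t => by positivity
      · apply Eventually.of_forall
        intro t ht
        have : uIoc y x ⊆ uIoc a b := by
          rw [uIoc_of_le hab.le]
          intro s hs
          rw [mem_uIoc] at hs
          rcases hs with hs | hs
          · exact ⟨by linarith [hy.1], by linarith [hx.2]⟩
          · exact ⟨by linarith [hx.1], by linarith [hy.2]⟩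
        rw [uIoc_of_le hab.le] at this
        exact this ht
    rw [integral_const_mul] at h2
    have h3 := hz2.integral_abs_mul_le hg'
    have h4 := le_abs_self (∫ t in y..x, 2 * (z t * g' t))
    linarith
  have hint : ∫ y in Ioo a b, z x ^ 2 ≤
      ∫ y in Ioo a b, (z y ^ 2 + 2 * (√(sqOm a b z) * √(sqOm a b g'))) := by
    apply setIntegral_mono_on (integrableOn_const (by simp)) (hz2.2.add (integrableOn_const (by simp)))
      measurableSet_Ioo
    intro y hy
    exact hdiff y (Ioo_subset_Icc_self hy)
  rw [integral_add hz2.2 (integrableOn_const (by simp))] at hint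
  simp only [integral_const, MeasurableSet.univ, measureReal_restrict_apply, univ_inter,
    Real.volume_real_Ioo_of_le hab.le, smul_eq_mul] at hint
  have hL : 0 < b - a := by linarith
  have : z x ^ 2 = (b - a)⁻¹ * ((b - a) * z x ^ 2) := by field_simp
  change z x ^ 2 ≤ _
  rw [this]
  calc _ ≤ (b - a)⁻¹ * (sqOm a b z + (b - a) * (2 * (√(sqOm a b z) * √(sqOm a b g')))) :=
        mul_le_mul_of_nonneg_left hint (by positivity)
    _ = _ := by field_simp

/-- The Gagliardo–Nirenberg inequality on a bounded interval. -/
lemma WeakDerivI.sq_le {a b : ℝ} (hab : a < b) {g g' : ℝ → ℝ} (hg : MemL2 a b g)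
    (hg' : MemL2 a b g') (h : WeakDerivI a b g g') :
    ∀ᵐ x ∂volume.restrict (Ioo a b),
      g x ^ 2 ≤ (b - a)⁻¹ * sqOm a b g + 2 * √(sqOm a b g) * √(sqOm a b g') := by
  obtain ⟨c, hc⟩ := h.exists_primitive hab hg.integrableOn hg'.integrableOn
  have he : sqOm a b g = sqOm a b (fun x => c + ∫ s in a..x, g' s) :=
    integral_congr_ae (hc.mono fun x hx => by simp only [hx])
  filter_upwards [hc, ae_restrict_mem measurableSet_Ioo] with x hx hm
  rw [hx, he]
  exact hg'.sqOm_primitive_le hab c (Ioo_subset_Icc_self hm)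

lemma WeakDerivI.integral_mul_deriv {a b : ℝ} (hab : a < b) {g g' ψ : ℝ → ℝ}
    (hg : IntegrableOn g (Ioo a b)) (hg' : IntegrableOn g' (Ioo a b)) (h : WeakDerivI a b g g')
    (hψ : ContDiff ℝ (⊤ : ℕ∞) ψ) (ha : ψ a = 0) (hb : ψ b = 0) :
    ∫ x in Ioo a b, g x * deriv ψ x = - ∫ x in Ioo a b, g' x * ψ x := by
  obtain ⟨c, hc⟩ := h.exists_primitive hab hg hg'
  have hg'i : IntervalIntegrable g' volume a b := by
    rw [intervalIntegrable_iff_integrableOn_Ioo_of_le hab.le]; exact hg'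
  have h2 := integral_primitive_mul_deriv hg'i c hψ
  rw [ha, hb] at h2
  simp only [intervalIntegral.integral_of_le hab.le, integral_Ioc_eq_integral_Ioo] at h2
  simp only [mul_zero, sub_zero, zero_sub] at h2
  rw [← h2, ← integral_Ioc_eq_integral_Ioo]
  rw [integral_Ioc_eq_integral_Ioo]
  exact integral_congr_ae (hc.mono fun x hx => by
    simp only [hx, intervalIntegral])

/-- In dimension one in time, a continuous function with an integrable weak derivative is the
primitive of that derivative. -/
lemma WeakDerivI.exists_primitive_of_continuousOn {T : ℝ} (hT : 0 < T) {z r : ℝ → ℝ}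
    (hz : ContinuousOn z (Icc 0 T)) (hr : IntegrableOn r (Ioo 0 T)) (h : WeakDerivI 0 T z r) :
    ∃ c, ∀ t ∈ Icc 0 T, z t = c + ∫ s in (0 : ℝ)..t, r s := by
  obtain ⟨c, hc⟩ := h.exists_primitive hT (hz.integrableOn_Icc.mono_set Ioo_subset_Icc_self) hr
  refine ⟨c, ?_⟩
  have hri : IntervalIntegrable r volume 0 T := by
    rw [intervalIntegrable_iff_integrableOn_Ioo_of_le hT.le]; exact hr
  have hRc := (absolutelyContinuousOnInterval_primitive hri c).continuousOn
  rw [uIcc_of_le hT.le] at hRc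
  apply Measure.eqOn_Icc_of_ae_eq volume hT.ne _ hz hRc
  rw [restrict_Ioo_eq_restrict_Icc] at hc
  exact hc

lemma exists_eq_zero_of_tsupport_subset {T : ℝ} {χ : ℝ → ℝ} (h : tsupport χ ⊆ Ioo 0 T) :
    ∃ T' < T, ∀ t, T' ≤ t → χ t = 0 := by
  rcases (tsupport χ).eq_empty_or_nonempty with he | hne
  · refine ⟨T - 1, by linarith, fun t _ => ?_⟩
    apply image_eq_zero_of_notMem_tsupport; simp [he]
  · have hc : IsCompact (tsupport χ) :=
      isCompact_Icc.of_isClosed_subset (isClosed_tsupport χ) (h.trans Ioo_subset_Icc_self)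
    obtain ⟨β, hβ, hβ'⟩ := hc.exists_isGreatest hne
    refine ⟨(β + T) / 2, by linarith [(h hβ).2], fun t ht => ?_⟩
    apply image_eq_zero_of_notMem_tsupport
    intro hm
    have := hβ' hm
    linarith [(h hβ).2]

lemma exists_cutoff {T : ℝ} (hT : 0 < T) : ∃ χ : ℝ → ℝ, ContDiff ℝ (⊤ : ℕ∞) χ ∧ χ 0 = 1 ∧
    ∃ T' < T, ∀ t, T' ≤ t → χ t = 0 := by
  refine ⟨fun t => Real.smoothTransition (1 - 2 * t / T), ?_, by simp, T / 2, by linarith, ?_⟩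
  · exact Real.smoothTransition.contDiff.comp (by fun_prop)
  · intro t ht
    apply Real.smoothTransition.zero_of_nonpos
    rw [sub_nonpos, le_div_iff₀ hT]; linarith

lemma integral_primitive_mul_deriv_of_cutoff {T : ℝ} (hT : 0 < T) {z r χ : ℝ → ℝ} {c : ℝ}
    (hr : IntegrableOn r (Ioo 0 T)) (hz : ∀ t ∈ Icc 0 T, z t = c + ∫ s in (0 : ℝ)..t, r s)
    (hχ : ContDiff ℝ (⊤ : ℕ∞) χ) (hχT : χ T = 0) :
    ∫ t in Ioo 0 T, z t * deriv χ t = - c * χ 0 - ∫ t in Ioo 0 T, r t * χ t := by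
  have hri : IntervalIntegrable r volume 0 T := by
    rw [intervalIntegrable_iff_integrableOn_Ioo_of_le hT.le]; exact hr
  have h2 := integral_primitive_mul_deriv hri c hχ
  rw [hχT] at h2
  rw [intervalIntegral.integral_of_le hT.le, intervalIntegral.integral_of_le (f := fun t => r t * χ t) hT.le,
    integral_Ioc_eq_integral_Ioo, integral_Ioc_eq_integral_Ioo] at h2
  rw [setIntegral_congr_fun (g := fun t => (c + ∫ s in (0 : ℝ)..t, r s) * deriv χ t)
    measurableSet_Ioo (fun t ht => by simp only [hz t (Ioo_subset_Icc_self ht)]), h2]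
  ring

/-- A function satisfying a first-order equation weakly, with initial datum. -/
lemma eq_primitive_of_weak {T : ℝ} (hT : 0 < T) {z r : ℝ → ℝ} {z₀ : ℝ}
    (hz : ContinuousOn z (Icc 0 T)) (hr : IntegrableOn r (Ioo 0 T))
    (h : ∀ χ : ℝ → ℝ, ContDiff ℝ (⊤ : ℕ∞) χ → (∃ T' < T, ∀ t, T' ≤ t → χ t = 0) →
      ∫ t in Ioo 0 T, z t * deriv χ t = - z₀ * χ 0 - ∫ t in Ioo 0 T, r t * χ t) :
    ∀ t ∈ Icc 0 T, z t = z₀ + ∫ s in (0 : ℝ)..t, r s := by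
  have hw : WeakDerivI 0 T z r := by
    intro χ hχ hs
    have h0 : χ 0 = 0 := image_eq_zero_of_notMem_tsupport fun hm => (hs hm).1.false
    rw [h χ hχ (exists_eq_zero_of_tsupport_subset hs), h0]; ring
  obtain ⟨c, hc⟩ := hw.exists_primitive_of_continuousOn hT hz hr
  obtain ⟨χ, hχ, hχ0, T', hT', hχT⟩ := exists_cutoff hT
  have h1 := h χ hχ ⟨T', hT', hχT⟩
  have h2 := integral_primitive_mul_deriv_of_cutoff hT hr hc hχ (hχT T hT'.le)
  rw [hχ0] at h1 h2
  have : c = z₀ := by linarith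
  rw [← this]; exact hc

/-- A function satisfying a second-order equation weakly, with initial data. -/
lemma eq_primitive_of_weak_second {T : ℝ} (hT : 0 < T) {z v p : ℝ → ℝ} {z₀ v₀ : ℝ}
    (hz : ContinuousOn z (Icc 0 T)) (hv : ContinuousOn v (Icc 0 T)) (hp : IntegrableOn p (Ioo 0 T))
    (hzv : WeakDerivI 0 T z v)
    (h : ∀ χ : ℝ → ℝ, ContDiff ℝ (⊤ : ℕ∞) χ → (∃ T' < T, ∀ t, T' ≤ t → χ t = 0) →
      (∫ t in Ioo 0 T, z t * deriv (deriv χ) t) - v₀ * χ 0 + z₀ * deriv χ 0 =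
        ∫ t in Ioo 0 T, p t * χ t) :
    (∀ t ∈ Icc 0 T, z t = z₀ + ∫ s in (0 : ℝ)..t, v s) ∧
      ∀ t ∈ Icc 0 T, v t = v₀ + ∫ s in (0 : ℝ)..t, p s := by
  have hvi : IntegrableOn v (Ioo 0 T) := hv.integrableOn_Icc.mono_set Ioo_subset_Icc_self
  obtain ⟨c, hc⟩ := hzv.exists_primitive_of_continuousOn hT hz hvi
  have hd : ∀ χ : ℝ → ℝ, ContDiff ℝ (⊤ : ℕ∞) χ → ContDiff ℝ (⊤ : ℕ∞) (deriv χ) :=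
    fun χ hχ => (contDiff_infty_iff_deriv.mp hχ).2
  have hdT : ∀ χ : ℝ → ℝ, (∃ T' < T, ∀ t, T' ≤ t → χ t = 0) → deriv χ T = 0 := by
    rintro χ ⟨T', hT', hχ⟩
    have : χ =ᶠ[nhds T] fun _ => 0 := by
      filter_upwards [lt_mem_nhds hT'] with t ht using hχ t ht.le
    rw [this.deriv_eq]; simp
  have h' : ∀ χ : ℝ → ℝ, ContDiff ℝ (⊤ : ℕ∞) χ → (∃ T' < T, ∀ t, T' ≤ t → χ t = 0) →
      ∫ t in Ioo 0 T, v t * deriv χ t =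
        (z₀ - c) * deriv χ 0 - v₀ * χ 0 - ∫ t in Ioo 0 T, p t * χ t := by
    intro χ hχ hχT
    have h1 := h χ hχ hχT
    have h2 := integral_primitive_mul_deriv_of_cutoff hT hvi hc (hd χ hχ) (hdT χ hχT)
    linarith
  have hw : WeakDerivI 0 T v p := by
    intro χ hχ hs
    have h0 : χ 0 = 0 := image_eq_zero_of_notMem_tsupport fun hm => (hs hm).1.false
    have h0' : deriv χ 0 = 0 := image_eq_zero_of_notMem_tsupport fun hm =>
      (hs (tsupport_deriv_subset hm)).1.false
    rw [h' χ hχ (exists_eq_zero_of_tsupport_subset hs), h0, h0']; ring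
  obtain ⟨d, hdd⟩ := hw.exists_primitive_of_continuousOn hT hv hp
  have h'' : ∀ χ : ℝ → ℝ, ContDiff ℝ (⊤ : ℕ∞) χ → (∃ T' < T, ∀ t, T' ≤ t → χ t = 0) →
      - d * χ 0 = (z₀ - c) * deriv χ 0 - v₀ * χ 0 := by
    intro χ hχ hχT
    have h1 := h' χ hχ hχT
    obtain ⟨T', hT', hχ'⟩ := hχT
    have h2 := integral_primitive_mul_deriv_of_cutoff hT hp hdd hχ (hχ' T hT'.le)
    linarith
  obtain ⟨χ, hχ, hχ0, T', hT', hχT⟩ := exists_cutoff hT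
  have hcz : c = z₀ := by
    have h1 := h'' (fun t => t * χ t) (contDiff_id.mul hχ)
      ⟨T', hT', fun t ht => by simp [hχT t ht]⟩
    have h2 : deriv (fun t => t * χ t) 0 = 1 := by
      have hχd : HasDerivAt χ (deriv χ 0) 0 :=
        ((hχ.differentiable (by simp)) 0).hasDerivAt
      have := (hasDerivAt_id (0 : ℝ)).mul hχd
      have h3 : HasDerivAt (fun t => t * χ t) (1 * χ 0 + 0 * deriv χ 0) 0 := this
      rw [h3.deriv, hχ0]; ring
    rw [h2] at h1
    linarith
  have hdv : d = v₀ := by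
    have h1 := h'' χ hχ ⟨T', hT', hχT⟩
    rw [hcz, hχ0] at h1
    linarith
  rw [← hcz, ← hdv]
  exact ⟨hc, hdd⟩

/-- The Neumann frequencies of the interval `(a, b)`. -/
def modeFreq (a b : ℝ) (n : ℕ) : ℝ := n * (Real.pi / (b - a))

/-- The Neumann eigenfunctions of the interval `(a, b)`. -/
def cosMode (a b : ℝ) (n : ℕ) (x : ℝ) : ℝ := Real.cos (modeFreq a b n * (x - a))

/-- The Dirichlet eigenfunctions of the interval `(a, b)`. -/
def sinMode (a b : ℝ) (n : ℕ) (x : ℝ) : ℝ := Real.sin (modeFreq a b n * (x - a))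

/-- The normalising weights for the eigenfunctions. -/
def modeWeight (a b : ℝ) (n : ℕ) : ℝ := if n = 0 then (b - a)⁻¹ else 2 * (b - a)⁻¹

lemma modeFreq_succ (a b : ℝ) (n : ℕ) : modeFreq a b (n + 1) = modeFreq a b n + modeFreq a b 1 := by
  simp [modeFreq]; ring

lemma cosMode_zero (a b x : ℝ) : cosMode a b 0 x = 1 := by simp [cosMode, modeFreq]

lemma sinMode_zero (a b x : ℝ) : sinMode a b 0 x = 0 := by simp [sinMode, modeFreq]

lemma contDiff_cosMode (a b : ℝ) (n : ℕ) : ContDiff ℝ (⊤ : ℕ∞) (cosMode a b n) := by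
  unfold cosMode; fun_prop

lemma contDiff_sinMode (a b : ℝ) (n : ℕ) : ContDiff ℝ (⊤ : ℕ∞) (sinMode a b n) := by
  unfold sinMode; fun_prop

lemma hasDerivAt_cosMode (a b : ℝ) (n : ℕ) (x : ℝ) :
    HasDerivAt (cosMode a b n) (-modeFreq a b n * sinMode a b n x) x := by
  have h : HasDerivAt (fun y => modeFreq a b n * (y - a)) (modeFreq a b n) x := by
    simpa using ((hasDerivAt_id x).sub_const a).const_mul (modeFreq a b n)
  refine h.cos.congr_deriv ?_
  simp only [sinMode]; ring

lemma hasDerivAt_sinMode (a b : ℝ) (n : ℕ) (x : ℝ) :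
    HasDerivAt (sinMode a b n) (modeFreq a b n * cosMode a b n x) x := by
  have h : HasDerivAt (fun y => modeFreq a b n * (y - a)) (modeFreq a b n) x := by
    simpa using ((hasDerivAt_id x).sub_const a).const_mul (modeFreq a b n)
  refine h.sin.congr_deriv ?_
  simp only [cosMode]; ring

lemma abs_cosMode_le (a b : ℝ) (n : ℕ) (x : ℝ) : |cosMode a b n x| ≤ 1 := Real.abs_cos_le_one _

lemma sinMode_left (a b : ℝ) (n : ℕ) : sinMode a b n a = 0 := by simp [sinMode]

lemma sinMode_right {a b : ℝ} (hab : a < b) (n : ℕ) : sinMode a b n b = 0 := by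
  have : b - a ≠ 0 := by linarith
  rw [sinMode, modeFreq, mul_assoc, div_mul_cancel₀ _ this, Real.sin_nat_mul_pi]

lemma modeWeight_pos {a b : ℝ} (hab : a < b) (n : ℕ) : 0 < modeWeight a b n := by
  have : 0 < (b - a)⁻¹ := inv_pos.mpr (by linarith)
  unfold modeWeight; split_ifs <;> positivity

lemma integral_cos_int {a b : ℝ} (hab : a < b) (k : ℤ) :
    ∫ x in Ioo a b, Real.cos (k * (Real.pi / (b - a)) * (x - a)) = if k = 0 then b - a else 0 := by
  have hL : b - a ≠ 0 := by linarith
  split_ifs with hk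
  · simp [hk, hab.le]
  · have hc : (k * (Real.pi / (b - a)) : ℝ) ≠ 0 := by
      have : (k : ℝ) ≠ 0 := by exact_mod_cast hk
      have := Real.pi_ne_zero
      positivity
    rw [← integral_Ioc_eq_integral_Ioo, ← intervalIntegral.integral_of_le hab.le]
    have h1 := intervalIntegral.integral_eq_sub_of_hasDerivAt (a := a) (b := b)
      (f := fun x => Real.sin (k * (Real.pi / (b - a)) * (x - a)) / (k * (Real.pi / (b - a))))
      (f' := fun x => Real.cos (k * (Real.pi / (b - a)) * (x - a))) (fun x _ => by
        have := ((((hasDerivAt_id x).sub_const a).const_mul (k * (Real.pi / (b - a)))).sin).div_const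
          (k * (Real.pi / (b - a)))
        refine this.congr_deriv ?_
        simp only [id_eq, mul_one]
        field_simp) (by apply Continuous.intervalIntegrable; fun_prop)
    rw [h1, mul_assoc (k : ℝ), mul_assoc (k : ℝ), div_mul_cancel₀ _ hL]
    simp [Real.sin_int_mul_pi]

lemma cosMode_mul_cosMode (a b : ℝ) (m n : ℕ) (x : ℝ) : cosMode a b m x * cosMode a b n x =
    (Real.cos (((m - n : ℤ) : ℝ) * (Real.pi / (b - a)) * (x - a)) +
      Real.cos (((m + n : ℤ) : ℝ) * (Real.pi / (b - a)) * (x - a))) / 2 := by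
  simp only [cosMode, modeFreq]
  push_cast
  rw [sub_mul, sub_mul, add_mul, add_mul, Real.cos_sub, Real.cos_add]
  ring

lemma sinMode_mul_sinMode (a b : ℝ) (m n : ℕ) (x : ℝ) : sinMode a b m x * sinMode a b n x =
    (Real.cos (((m - n : ℤ) : ℝ) * (Real.pi / (b - a)) * (x - a)) -
      Real.cos (((m + n : ℤ) : ℝ) * (Real.pi / (b - a)) * (x - a))) / 2 := by
  simp only [sinMode, modeFreq]
  push_cast
  rw [sub_mul, sub_mul, add_mul, add_mul, Real.cos_sub, Real.cos_add]
  ring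

lemma integrableOn_cos (a b c : ℝ) :
    Integrable (fun x => Real.cos (c * (x - a))) (volume.restrict (Ioo a b)) :=
  ((Continuous.continuousOn (by fun_prop)).integrableOn_Icc).mono_set Ioo_subset_Icc_self

lemma integral_cosMode_mul_cosMode {a b : ℝ} (hab : a < b) (m n : ℕ) :
    ∫ x in Ioo a b, cosMode a b m x * cosMode a b n x =
      if m = n then (modeWeight a b n)⁻¹ else 0 := by
  simp_rw [cosMode_mul_cosMode]
  rw [integral_div, integral_add (integrableOn_cos a b _) (integrableOn_cos a b _),
    integral_cos_int hab, integral_cos_int hab]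
  rcases eq_or_ne m n with rfl | h
  · rcases eq_or_ne m 0 with rfl | h0
    · simp [modeWeight]
    · have : ¬ ((m : ℤ) + m = 0) := by omega
      simp [modeWeight, h0, this]
      ring
  · have h1 : ¬ ((m : ℤ) + n = 0) := by omega
    have h2 : ¬ ((m : ℤ) - n = 0) := by omega
    simp [h, h1, h2]

lemma integral_sinMode_mul_sinMode {a b : ℝ} (hab : a < b) (m n : ℕ) :
    ∫ x in Ioo a b, sinMode a b m x * sinMode a b n x =
      if m = n ∧ n ≠ 0 then (modeWeight a b n)⁻¹ else 0 := by
  simp_rw [sinMode_mul_sinMode]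
  rw [integral_div, integral_sub (integrableOn_cos a b _) (integrableOn_cos a b _),
    integral_cos_int hab, integral_cos_int hab]
  rcases eq_or_ne m n with rfl | h
  · rcases eq_or_ne m 0 with rfl | h0
    · simp
    · have : ¬ ((m : ℤ) + m = 0) := by omega
      simp [modeWeight, h0, this]
      ring
  · have h1 : ¬ ((m : ℤ) + n = 0) := by omega
    have h2 : ¬ ((m : ℤ) - n = 0) := by omega
    simp [h, h1, h2]

lemma cosMode_one_mul (a b : ℝ) (n : ℕ) (x : ℝ) : cosMode a b 1 x * cosMode a b (n + 1) x =
    (cosMode a b n x + cosMode a b (n + 2) x) / 2 := by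
  have h1 : modeFreq a b (n + 2) * (x - a) =
      modeFreq a b (n + 1) * (x - a) + modeFreq a b 1 * (x - a) := by
    rw [modeFreq_succ a b (n + 1)]; ring
  have h2 : modeFreq a b n * (x - a) =
      modeFreq a b (n + 1) * (x - a) - modeFreq a b 1 * (x - a) := by
    rw [modeFreq_succ a b n]; ring
  simp only [cosMode]
  rw [h1, h2, Real.cos_add, Real.cos_sub]; ring

lemma sinMode_one_mul_cosMode (a b : ℝ) (n : ℕ) (x : ℝ) :
    sinMode a b 1 x * cosMode a b (n + 1) x = (sinMode a b (n + 2) x - sinMode a b n x) / 2 := by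
  have h1 : modeFreq a b (n + 2) * (x - a) =
      modeFreq a b (n + 1) * (x - a) + modeFreq a b 1 * (x - a) := by
    rw [modeFreq_succ a b (n + 1)]; ring
  have h2 : modeFreq a b n * (x - a) =
      modeFreq a b (n + 1) * (x - a) - modeFreq a b 1 * (x - a) := by
    rw [modeFreq_succ a b n]; ring
  simp only [cosMode, sinMode]
  rw [h1, h2, Real.sin_add, Real.sin_sub]; ring

/-- An integrable function orthogonal to all cosine modes vanishes. -/
lemma ae_eq_zero_of_integral_mul_cosMode {a b : ℝ} (hab : a < b) {g : ℝ → ℝ}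
    (hg : IntegrableOn g (Ioo a b)) (h : ∀ n, ∫ x in Ioo a b, g x * cosMode a b n x = 0) :
    ∀ᵐ x ∂volume.restrict (Ioo a b), g x = 0 := by
  have hL : 0 < b - a := by linarith
  have hcc : ∀ n, Continuous (cosMode a b n) := fun n => (contDiff_cosMode a b n).continuous
  have hpow : ∀ j n : ℕ, ∫ x in Ioo a b, g x * cosMode a b 1 x ^ j * cosMode a b n x = 0 := by
    intro j
    induction j with
    | zero => simpa using h
    | succ j ih =>
      intro n
      cases n with
      | zero =>
        rw [← ih 1]
        simp_rw [cosMode_zero]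
        congr 1; ext x; ring
      | succ n =>
        have h1 : ∀ x, g x * cosMode a b 1 x ^ (j + 1) * cosMode a b (n + 1) x =
            (g x * cosMode a b 1 x ^ j * cosMode a b n x +
              g x * cosMode a b 1 x ^ j * cosMode a b (n + 2) x) / 2 := by
          intro x
          have := cosMode_one_mul a b n x
          rw [pow_succ]
          linear_combination g x * cosMode a b 1 x ^ j * this
        simp_rw [h1]
        have hi : IntegrableOn (fun x => g x * cosMode a b 1 x ^ j) (Ioo a b) :=
          hg.mul_continuous_of_Ioo ((hcc 1).pow j)
        rw [integral_div, integral_add (hi.mul_continuous_of_Ioo (hcc n))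
          (hi.mul_continuous_of_Ioo (hcc (n + 2))), ih, ih]
        simp
  have hpoly : ∀ p : Polynomial ℝ, ∫ x in Ioo a b, g x * p.eval (cosMode a b 1 x) = 0 := by
    intro p
    simp_rw [Polynomial.eval_eq_sum, Polynomial.sum, Finset.mul_sum]
    rw [integral_finsetSum]
    · apply Finset.sum_eq_zero
      intro j _
      have := hpow j 0
      simp_rw [cosMode_zero, mul_one] at this
      have h2 : ∀ x, g x * (p.coeff j * cosMode a b 1 x ^ j) =
          p.coeff j * (g x * cosMode a b 1 x ^ j) := fun x => by ring
      simp_rw [h2]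
      rw [integral_const_mul, this, mul_zero]
    · intro j _
      exact hg.mul_continuous_of_Ioo (((hcc 1).pow j).const_mul _)
  have hcont : ∀ ψ : ℝ → ℝ, Continuous ψ → ∫ x in Ioo a b, g x * ψ x = 0 := by
    intro ψ hψ
    set k : ℝ → ℝ := fun y => ψ (a + (b - a) / Real.pi * Real.arccos y) with hk
    have hkc : Continuous k := by
      rw [hk]
      exact hψ.comp (continuous_const.add (continuous_const.mul Real.continuous_arccos))
    have hkψ : ∀ x ∈ Ioo a b, k (cosMode a b 1 x) = ψ x := by
      intro x hx
      have hp := Real.pi_pos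
      rw [hk]
      simp only [cosMode, modeFreq, Nat.cast_one, one_mul]
      rw [Real.arccos_cos]
      · congr 1; field_simp; ring
      · have := hx.1; exact mul_nonneg (by positivity) (by linarith)
      · rw [div_mul_eq_mul_div, div_le_iff₀ hL]
        exact mul_le_mul_of_nonneg_left (by linarith [hx.2]) hp.le
    have hsmall : ∀ ε > 0, |∫ x in Ioo a b, g x * ψ x| ≤ ε * ∫ x in Ioo a b, |g x| := by
      intro ε hε
      obtain ⟨p, hp⟩ := exists_polynomial_near_of_continuousOn (-1) 1 k hkc.continuousOn ε hε
      have hpi : IntegrableOn (fun x => g x * p.eval (cosMode a b 1 x)) (Ioo a b) :=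
        hg.mul_continuous_of_Ioo (p.continuous.comp (hcc 1))
      have : ∫ x in Ioo a b, g x * ψ x =
          ∫ x in Ioo a b, (g x * ψ x - g x * p.eval (cosMode a b 1 x)) := by
        rw [integral_sub (hg.mul_continuous_of_Ioo hψ) hpi, hpoly, sub_zero]
      rw [this, ← integral_const_mul]
      refine (abs_integral_le_integral_abs).trans ?_
      apply setIntegral_mono_on
        ((hg.mul_continuous_of_Ioo hψ).sub hpi).abs (hg.abs.const_mul ε) measurableSet_Ioo
      intro x hx
      have h1 := hp (cosMode a b 1 x) (abs_le.mp (abs_cosMode_le a b 1 x))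
      rw [hkψ x hx] at h1
      rw [Pi.sub_apply, ← mul_sub, abs_mul, mul_comm, abs_sub_comm]
      exact mul_le_mul_of_nonneg_right h1.le (abs_nonneg _)
    by_contra hne
    have hpos : 0 < |∫ x in Ioo a b, g x * ψ x| := abs_pos.mpr hne
    set I := ∫ x in Ioo a b, |g x|
    have hI : 0 ≤ I := integral_nonneg fun _ => abs_nonneg _
    have h1 := hsmall (|∫ x in Ioo a b, g x * ψ x| / (2 * (I + 1))) (by positivity)
    rw [div_mul_eq_mul_div, le_div_iff₀ (by positivity)] at h1
    nlinarith
  have := isOpen_Ioo.ae_eq_zero_of_integral_contDiff_smul_eq_zero (μ := volume) (f := g)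
    (U := Ioo a b) hg.locallyIntegrableOn (fun ψ hψ _ hs => by
      have h1 := hcont ψ hψ.continuous
      rw [← h1, ← integral_indicator measurableSet_Ioo]
      congr 1; ext x
      by_cases hx : x ∈ Ioo a b
      · simp [hx, mul_comm]
      · have : ψ x = 0 := image_eq_zero_of_notMem_tsupport fun hm => hx (hs hm)
        simp [this, hx])
  rw [ae_restrict_iff' measurableSet_Ioo]
  exact this

/-- An integrable function orthogonal to all sine modes vanishes. -/
lemma ae_eq_zero_of_integral_mul_sinMode {a b : ℝ} (hab : a < b) {g : ℝ → ℝ}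
    (hg : IntegrableOn g (Ioo a b)) (h : ∀ n, ∫ x in Ioo a b, g x * sinMode a b n x = 0) :
    ∀ᵐ x ∂volume.restrict (Ioo a b), g x = 0 := by
  have hsc : ∀ n, Continuous (sinMode a b n) := fun n => (contDiff_sinMode a b n).continuous
  have hL : 0 < b - a := by linarith
  have h1 := ae_eq_zero_of_integral_mul_cosMode hab (hg.mul_continuous_of_Ioo (hsc 1)) (by
    intro n
    cases n with
    | zero => simpa [cosMode_zero] using h 1
    | succ n =>
      have h1 : ∀ x, g x * sinMode a b 1 x * cosMode a b (n + 1) x =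
          (g x * sinMode a b (n + 2) x - g x * sinMode a b n x) / 2 := by
        intro x
        linear_combination g x * sinMode_one_mul_cosMode a b n x
      simp_rw [h1]
      rw [integral_div, integral_sub (hg.mul_continuous_of_Ioo (hsc _))
        (hg.mul_continuous_of_Ioo (hsc _)), h, h]
      simp)
  filter_upwards [h1, ae_restrict_mem measurableSet_Ioo] with x hx hm
  refine (mul_eq_zero.mp hx).resolve_right (ne_of_gt ?_)
  have hp := Real.pi_pos
  simp only [sinMode, modeFreq, Nat.cast_one, one_mul]
  apply Real.sin_pos_of_pos_of_lt_pi
  · exact mul_pos (by positivity) (by linarith [hm.1])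
  · rw [div_mul_eq_mul_div, div_lt_iff₀ hL]
    exact mul_lt_mul_of_pos_left (by linarith [hm.2]) hp

/-- Parseval's identity for a complete orthonormal sequence of continuous functions. -/
lemma hasSum_sq_integral_of_orthonormal {a b : ℝ} {e : ℕ → ℝ → ℝ} (he : ∀ n, Continuous (e n))
    (horth : ∀ m n, ∫ x in Ioo a b, e m x * e n x = if m = n then 1 else 0)
    (hcomp : ∀ g, MemL2 a b g → (∀ n, ∫ x in Ioo a b, g x * e n x = 0) →
      ∀ᵐ x ∂volume.restrict (Ioo a b), g x = 0) {g : ℝ → ℝ} (hg : MemL2 a b g) :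
    HasSum (fun n => (∫ x in Ioo a b, g x * e n x) ^ 2) (sqOm a b g) := by
  have hem : ∀ n, MemLp (e n) 2 (volume.restrict (Ioo a b)) := fun n => (he n).memL2.memLp
  have hinner : ∀ (p q : ℝ → ℝ) (hp : MemLp p 2 (volume.restrict (Ioo a b)))
      (hq : MemLp q 2 (volume.restrict (Ioo a b))),
      inner ℝ (hp.toLp p) (hq.toLp q) = ∫ x in Ioo a b, q x * p x := by
    intro p q hp hq
    rw [L2.inner_def]
    apply integral_congr_ae
    filter_upwards [hp.coeFn_toLp, hq.coeFn_toLp] with x h1 h2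
    rw [h1, h2]; simp [mul_comm]
  have ho : Orthonormal ℝ (fun n => (hem n).toLp (e n)) := by
    rw [orthonormal_iff_ite]
    intro i j
    rw [hinner, horth]
    simp [eq_comm]
  have hbot : (Submodule.span ℝ (Set.range fun n => (hem n).toLp (e n)))ᗮ = ⊥ := by
    rw [Submodule.eq_bot_iff]
    intro v hv
    have hvm := Lp.memLp v
    have h1 := hcomp v hvm.memL2 (fun n => by
      have := (Submodule.mem_orthogonal _ _).mp hv _ (Submodule.subset_span ⟨n, rfl⟩)
      rw [← Lp.toLp_coeFn v hvm, hinner] at this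
      exact this)
    rw [Lp.eq_zero_iff_ae_eq_zero]
    exact h1
  have hs := (HilbertBasis.mkOfOrthogonalEqBot ho hbot).hasSum_inner_mul_inner
    (hg.memLp.toLp g) (hg.memLp.toLp g)
  simp only [HilbertBasis.coe_mkOfOrthogonalEqBot, hinner] at hs
  simpa only [sqOm, sq, mul_comm (e _ _) (g _)] using hs

lemma hasSum_cosMode {a b : ℝ} (hab : a < b) {g : ℝ → ℝ} (hg : MemL2 a b g) :
    HasSum (fun n => modeWeight a b n * (∫ x in Ioo a b, g x * cosMode a b n x) ^ 2)
      (sqOm a b g) := by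
  have hw := modeWeight_pos hab
  have hsq : ∀ n, √(modeWeight a b n) * √(modeWeight a b n) = modeWeight a b n :=
    fun n => Real.mul_self_sqrt (hw n).le
  have hmul : ∀ (p : ℝ → ℝ) n, ∫ x in Ioo a b, p x * (√(modeWeight a b n) * cosMode a b n x) =
      √(modeWeight a b n) * ∫ x in Ioo a b, p x * cosMode a b n x := by
    intro p n
    rw [← integral_const_mul]; congr 1; ext x; ring
  have := hasSum_sq_integral_of_orthonormal (a := a) (b := b)
    (e := fun n x => √(modeWeight a b n) * cosMode a b n x)
    (fun n => ((contDiff_cosMode a b n).continuous).const_mul _) (fun m n => by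
      rw [hmul]
      simp_rw [mul_assoc]
      rw [integral_const_mul, integral_cosMode_mul_cosMode hab]
      split_ifs with h
      · rw [h, ← mul_assoc, hsq, mul_inv_cancel₀ (hw n).ne']
      · simp) (fun p hp h => by
      refine ae_eq_zero_of_integral_mul_cosMode hab hp.integrableOn fun n => ?_
      have := h n
      rw [hmul] at this
      exact (mul_eq_zero.mp this).resolve_left (Real.sqrt_pos.mpr (hw n)).ne') hg
  convert this using 2 with n
  rw [hmul, mul_pow, sq (√_), hsq]

lemma hasSum_sinMode {a b : ℝ} (hab : a < b) {g : ℝ → ℝ} (hg : MemL2 a b g) :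
    HasSum (fun n => modeWeight a b n * (∫ x in Ioo a b, g x * sinMode a b n x) ^ 2)
      (sqOm a b g) := by
  have hw := modeWeight_pos hab
  have hsq : ∀ n, √(modeWeight a b n) * √(modeWeight a b n) = modeWeight a b n :=
    fun n => Real.mul_self_sqrt (hw n).le
  have hmul : ∀ (p : ℝ → ℝ) n, ∫ x in Ioo a b, p x * (√(modeWeight a b n) * sinMode a b n x) =
      √(modeWeight a b n) * ∫ x in Ioo a b, p x * sinMode a b n x := by
    intro p n
    rw [← integral_const_mul]; congr 1; ext x; ring
  have := hasSum_sq_integral_of_orthonormal (a := a) (b := b)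
    (e := fun n x => √(modeWeight a b (n + 1)) * sinMode a b (n + 1) x)
    (fun n => ((contDiff_sinMode a b (n + 1)).continuous).const_mul _) (fun m n => by
      rw [hmul]
      simp_rw [mul_assoc]
      rw [integral_const_mul, integral_sinMode_mul_sinMode hab]
      by_cases h : m = n
      · simp only [h, ne_eq, Nat.add_eq_zero_iff, one_ne_zero, and_false, not_false_eq_true,
          and_self, if_true]
        rw [← mul_assoc, hsq, mul_inv_cancel₀ (hw (n + 1)).ne']
      · simp [h]) (fun p hp h => by
      refine ae_eq_zero_of_integral_mul_sinMode hab hp.integrableOn fun n => ?_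
      cases n with
      | zero => simp [sinMode_zero]
      | succ n =>
        have := h n
        rw [hmul] at this
        exact (mul_eq_zero.mp this).resolve_left (Real.sqrt_pos.mpr (hw (n + 1))).ne') hg
  rw [← hasSum_nat_add_iff' 1]
  simp only [Finset.range_one, Finset.sum_singleton, sinMode_zero, mul_zero, integral_zero, ne_eq,
    OfNat.ofNat_ne_zero, not_false_eq_true, zero_pow, sub_zero]
  simpa only [hmul, mul_pow, Real.sq_sqrt (hw _).le] using this

lemma restrict_Ioo_prod (a b T : ℝ) :
    (volume : Measure (ℝ × ℝ)).restrict (Ioo a b ×ˢ Ioo 0 T) =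
      (volume.restrict (Ioo a b)).prod (volume.restrict (Ioo 0 T)) := by
  rw [Measure.prod_restrict, Measure.volume_eq_prod]

section Slices

variable {a b T : ℝ} {F : ℝ → ℝ → ℝ}

lemma integrableOn_slice_ae
    (hF : IntegrableOn (fun p : ℝ × ℝ => F p.1 p.2) (Ioo a b ×ˢ Ioo 0 T)) :
    ∀ᵐ t ∂volume.restrict (Ioo 0 T), IntegrableOn (fun x => F x t) (Ioo a b) := by
  rw [IntegrableOn, restrict_Ioo_prod] at hF
  exact hF.prod_left_ae

lemma integrableOn_integral_slice
    (hF : IntegrableOn (fun p : ℝ × ℝ => F p.1 p.2) (Ioo a b ×ˢ Ioo 0 T)) :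
    IntegrableOn (fun t => ∫ x in Ioo a b, F x t) (Ioo 0 T) := by
  rw [IntegrableOn, restrict_Ioo_prod] at hF
  exact hF.integral_prod_right

lemma integrableOn_integral_slice_left
    (hF : IntegrableOn (fun p : ℝ × ℝ => F p.1 p.2) (Ioo a b ×ˢ Ioo 0 T)) :
    IntegrableOn (fun x => ∫ t in Ioo 0 T, F x t) (Ioo a b) := by
  rw [IntegrableOn, restrict_Ioo_prod] at hF
  exact hF.integral_prod_left

lemma intOmT_eq_integral_integral
    (hF : IntegrableOn (fun p : ℝ × ℝ => F p.1 p.2) (Ioo a b ×ˢ Ioo 0 T)) :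
    intOmT a b T F = ∫ t in Ioo 0 T, ∫ x in Ioo a b, F x t := by
  rw [IntegrableOn, restrict_Ioo_prod] at hF
  rw [intOmT, restrict_Ioo_prod, integral_prod_symm _ hF]

lemma intOmT_eq_integral_integral_left
    (hF : IntegrableOn (fun p : ℝ × ℝ => F p.1 p.2) (Ioo a b ×ˢ Ioo 0 T)) :
    intOmT a b T F = ∫ x in Ioo a b, ∫ t in Ioo 0 T, F x t := by
  rw [IntegrableOn, restrict_Ioo_prod] at hF
  rw [intOmT, restrict_Ioo_prod, integral_prod _ hF]

lemma integrableOn_mul_tensor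
    (hF : IntegrableOn (fun p : ℝ × ℝ => F p.1 p.2) (Ioo a b ×ˢ Ioo 0 T))
    {ψ χ : ℝ → ℝ} (hψ : Continuous ψ) (hχ : Continuous χ) :
    IntegrableOn (fun p : ℝ × ℝ => F p.1 p.2 * (ψ p.1 * χ p.2)) (Ioo a b ×ˢ Ioo 0 T) := by
  refine hF.mul_continuousOn_of_subset (K := Icc a b ×ˢ Icc 0 T) (Continuous.continuousOn ?_)
    (measurableSet_Ioo.prod measurableSet_Ioo) (isCompact_Icc.prod isCompact_Icc)
    (prod_mono Ioo_subset_Icc_self Ioo_subset_Icc_self)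
  exact (hψ.comp continuous_fst).mul (hχ.comp continuous_snd)

lemma intOmT_mul_tensor
    (hF : IntegrableOn (fun p : ℝ × ℝ => F p.1 p.2) (Ioo a b ×ˢ Ioo 0 T))
    {ψ χ : ℝ → ℝ} (hψ : Continuous ψ) (hχ : Continuous χ) :
    intOmT a b T (fun x t => F x t * (ψ x * χ t)) =
      ∫ t in Ioo 0 T, (∫ x in Ioo a b, F x t * ψ x) * χ t := by
  rw [intOmT_eq_integral_integral (integrableOn_mul_tensor hF hψ hχ)]
  congr 1; ext t
  rw [← integral_mul_const]
  congr 1; ext x; ring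

lemma intOmT_mul_tensor_left
    (hF : IntegrableOn (fun p : ℝ × ℝ => F p.1 p.2) (Ioo a b ×ˢ Ioo 0 T))
    {ψ χ : ℝ → ℝ} (hψ : Continuous ψ) (hχ : Continuous χ) :
    intOmT a b T (fun x t => F x t * (ψ x * χ t)) =
      ∫ x in Ioo a b, (∫ t in Ioo 0 T, F x t * χ t) * ψ x := by
  rw [intOmT_eq_integral_integral_left (integrableOn_mul_tensor hF hψ hχ)]
  congr 1; ext x
  rw [← integral_mul_const]
  congr 1; ext t; ring

lemma integrableOn_mul_slice
    (hF : IntegrableOn (fun p : ℝ × ℝ => F p.1 p.2) (Ioo a b ×ˢ Ioo 0 T))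
    {ψ : ℝ → ℝ} (hψ : Continuous ψ) :
    IntegrableOn (fun t => ∫ x in Ioo a b, F x t * ψ x) (Ioo 0 T) := by
  have := integrableOn_integral_slice (F := fun x t => F x t * (ψ x * 1))
    (integrableOn_mul_tensor hF hψ continuous_const)
  simpa only [mul_one] using this

lemma integrableOn_mul_slice_left
    (hF : IntegrableOn (fun p : ℝ × ℝ => F p.1 p.2) (Ioo a b ×ˢ Ioo 0 T))
    {χ : ℝ → ℝ} (hχ : Continuous χ) :
    IntegrableOn (fun x => ∫ t in Ioo 0 T, F x t * χ t) (Ioo a b) := by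
  have := integrableOn_integral_slice_left (F := fun x t => F x t * (1 * χ t))
    (integrableOn_mul_tensor hF continuous_const hχ)
  simpa only [one_mul] using this

end Slices

lemma ContL2.continuousOn_integral_mul {a b : ℝ} {J : Set ℝ} {w : ℝ → ℝ → ℝ}
    (hw : ContL2 a b J w) {ψ : ℝ → ℝ} (hψ : Continuous ψ) :
    ContinuousOn (fun t => ∫ x in Ioo a b, w x t * ψ x) J := by
  intro t₀ ht₀
  rw [ContinuousWithinAt, tendsto_iff_dist_tendsto_zero]
  have h1 : Tendsto (fun t => √(sqOm a b (fun x => w x t - w x t₀)) * √(sqOm a b ψ))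
      (nhdsWithin t₀ J) (nhds 0) := by
    simpa only [sqOm, Real.sqrt_zero, zero_mul] using
      ((hw.2 t₀ ht₀).sqrt).mul_const √(sqOm a b ψ)
  refine squeeze_zero' (Eventually.of_forall fun _ => dist_nonneg) ?_ h1
  filter_upwards [self_mem_nhdsWithin] with t ht
  have h2 := ((hw.1 t ht).sub (hw.1 t₀ ht₀)).abs_integral_mul_le hψ.memL2
  rw [Real.dist_eq, ← integral_sub ((hw.1 t ht).mul_integrableOn hψ.memL2)
    ((hw.1 t₀ ht₀).mul_integrableOn hψ.memL2)]
  simpa only [sub_mul] using h2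

lemma pdt_tensor (ψ χ : ℝ → ℝ) :
    pdt (fun x t => ψ x * χ t) = fun x t => ψ x * deriv χ t := by
  ext x t
  simp only [pdt]
  exact deriv_const_mul_field (ψ x)

lemma pdx_tensor (ψ χ : ℝ → ℝ) :
    pdx (fun x t => ψ x * χ t) = fun x t => deriv ψ x * χ t := by
  ext x t
  simp only [pdx]
  exact deriv_mul_const_field (χ t)

lemma contDiff_tensor {ψ χ : ℝ → ℝ} (hψ : ContDiff ℝ (⊤ : ℕ∞) ψ) (hχ : ContDiff ℝ (⊤ : ℕ∞) χ) :
    ContDiff ℝ (⊤ : ℕ∞) (uncurry fun x t => ψ x * χ t) :=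
  (hψ.comp contDiff_fst).mul (hχ.comp contDiff_snd)

lemma isCompact_tsupport_of_subset_Ioo {a b : ℝ} {ψ : ℝ → ℝ} (h : tsupport ψ ⊆ Ioo a b) :
    IsCompact (tsupport ψ) :=
  isCompact_Icc.of_isClosed_subset (isClosed_tsupport ψ) (h.trans Ioo_subset_Icc_self)

lemma deriv_cosMode (a b : ℝ) (n : ℕ) :
    deriv (cosMode a b n) = fun x => -modeFreq a b n * sinMode a b n x :=
  funext fun x => (hasDerivAt_cosMode a b n x).deriv

lemma deriv_sinMode (a b : ℝ) (n : ℕ) :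
    deriv (sinMode a b n) = fun x => modeFreq a b n * cosMode a b n x :=
  funext fun x => (hasDerivAt_sinMode a b n x).deriv

lemma ContDiff.smooth_deriv {χ : ℝ → ℝ} (hχ : ContDiff ℝ (⊤ : ℕ∞) χ) :
    ContDiff ℝ (⊤ : ℕ∞) (deriv χ) :=
  (contDiff_infty_iff_deriv.mp hχ).2

lemma integral_mul_deriv_sinMode (a b : ℝ) (g : ℝ → ℝ) (n : ℕ) :
    ∫ x in Ioo a b, g x * deriv (sinMode a b n) x =
      modeFreq a b n * ∫ x in Ioo a b, g x * cosMode a b n x := by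
  rw [← integral_const_mul, deriv_sinMode]
  congr 1; ext x; ring

lemma integral_mul_deriv_cosMode (a b : ℝ) (g : ℝ → ℝ) (n : ℕ) :
    ∫ x in Ioo a b, g x * deriv (cosMode a b n) x =
      -(modeFreq a b n * ∫ x in Ioo a b, g x * sinMode a b n x) := by
  rw [← integral_const_mul, ← integral_neg, deriv_cosMode]
  congr 1; ext x; ring

/-- The cosine coefficients of the zero-trace weak derivative. -/
lemma WeakDerivZ.integral_mul_cosMode {a b : ℝ} {g g' : ℝ → ℝ} (h : WeakDerivZ a b g g') (n : ℕ) :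
    ∫ x in Ioo a b, g' x * cosMode a b n x =
      modeFreq a b n * ∫ x in Ioo a b, g x * sinMode a b n x := by
  have h1 := h (cosMode a b n) (contDiff_cosMode a b n)
  rw [integral_mul_deriv_cosMode] at h1
  linarith

/-- The sine coefficients of the weak derivative. -/
lemma WeakDerivI.integral_mul_sinMode {a b : ℝ} (hab : a < b) {g g' : ℝ → ℝ}
    (hg : IntegrableOn g (Ioo a b)) (hg' : IntegrableOn g' (Ioo a b)) (h : WeakDerivI a b g g')
    (n : ℕ) : ∫ x in Ioo a b, g' x * sinMode a b n x =
      -(modeFreq a b n * ∫ x in Ioo a b, g x * cosMode a b n x) := by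
  have h1 := h.integral_mul_deriv hab hg hg' (contDiff_sinMode a b n) (sinMode_left a b n)
    (sinMode_right hab n)
  rw [integral_mul_deriv_sinMode] at h1
  linarith

/-- On `[0, T]`, the function `z` is the primitive of the integrable function `r` with initial
value `c`. -/
def IsPrimitiveOn (T c : ℝ) (r z : ℝ → ℝ) : Prop :=
  IntegrableOn r (Ioo 0 T) ∧ ∀ t ∈ Icc 0 T, z t = c + ∫ s in (0 : ℝ)..t, r s

section Modes

variable {a b T : ℝ} {f f' u0 u0x u0t Θ0 : ℝ → ℝ} {u ut ux Θ Θx : ℝ → ℝ → ℝ}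

/-- The equation satisfied by the cosine coefficients of the temperature. -/
lemma IsWeakSol.integral_mul_cosMode (hT : 0 < T)
    (hs : IsWeakSol a b T f f' u0 u0t Θ0 u ut ux Θ Θx) (hr : RegT a b T u ut ux Θ Θx) (n : ℕ) :
    IsPrimitiveOn T (∫ x in Ioo a b, Θ0 x * cosMode a b n x)
      (fun s => modeFreq a b n * (∫ x in Ioo a b, Θx x s * sinMode a b n x) +
        (∫ x in Ioo a b, f' (Θ x s) * Θx x s * ut x s * cosMode a b n x) -
        modeFreq a b n * ∫ x in Ioo a b, f (Θ x s) * ut x s * sinMode a b n x)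
      (fun t => ∫ x in Ioo a b, Θ x t * cosMode a b n x) := by
  have hc := contDiff_cosMode a b n
  have hsc := (contDiff_sinMode a b n).continuous
  have i1 := integrableOn_mul_slice hs.Θx_int hsc
  have i2 := integrableOn_mul_slice (F := fun x t => f' (Θ x t) * Θx x t * ut x t) hs.g2_int
    hc.continuous
  have i3 := integrableOn_mul_slice (F := fun x t => f (Θ x t) * ut x t) hs.g3_int hsc
  have i123 := ((i1.const_mul (modeFreq a b n)).add i2).sub (i3.const_mul (modeFreq a b n))
  refine ⟨i123, eq_primitive_of_weak hT (hr.Θ_cont.continuousOn_integral_mul hc.continuous)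
    i123 ?_⟩
  intro χ hχ hχT
  obtain ⟨T', hT', hχ0⟩ := hχT
  have hw := hs.weak_Θ (fun x t => cosMode a b n x * χ t)
    ⟨contDiff_tensor hc hχ, T', hT', fun x t ht => by simp [hχ0 t ht]⟩
  rw [pdt_tensor, pdx_tensor, intOmT_mul_tensor hs.Θ_int hc.continuous hχ.smooth_deriv.continuous,
    intOmT_mul_tensor hs.Θx_int hc.smooth_deriv.continuous hχ.continuous,
    intOmT_mul_tensor (F := fun x t => f' (Θ x t) * Θx x t * ut x t) hs.g2_int hc.continuous
      hχ.continuous,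
    intOmT_mul_tensor (F := fun x t => f (Θ x t) * ut x t) hs.g3_int hc.smooth_deriv.continuous
      hχ.continuous] at hw
  simp only [integral_mul_deriv_cosMode] at hw
  have h0 : intOm a b (fun x => Θ0 x * (cosMode a b n x * χ 0)) =
      (∫ x in Ioo a b, Θ0 x * cosMode a b n x) * χ 0 := by
    rw [intOm, ← integral_mul_const]
    congr 1; ext x; ring
  have j1 := IntegrableOn.mul_continuous_of_Ioo (i1.const_mul (modeFreq a b n)) hχ.continuous
  have j2 := i2.mul_continuous_of_Ioo hχ.continuous
  have j3 := IntegrableOn.mul_continuous_of_Ioo (i3.const_mul (modeFreq a b n)) hχ.continuous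
  have j12 : IntegrableOn (fun t =>
      modeFreq a b n * (∫ x in Ioo a b, Θx x t * sinMode a b n x) * χ t +
      (∫ x in Ioo a b, f' (Θ x t) * Θx x t * ut x t * cosMode a b n x) * χ t) (Ioo 0 T) := j1.add j2
  rw [h0] at hw
  simp only [neg_mul, integral_neg, neg_neg] at hw
  simp only [sub_mul, add_mul]
  rw [integral_sub j12 j3, integral_add j1 j2]
  linarith

/-- The weak time derivative of the sine coefficients of the displacement. -/
lemma IsWeakSol.weakDerivI_integral_mul
    (hs : IsWeakSol a b T f f' u0 u0t Θ0 u ut ux Θ Θx) {ψ : ℝ → ℝ} (hψ : Continuous ψ) :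
    WeakDerivI 0 T (fun t => ∫ x in Ioo a b, u x t * ψ x)
      (fun t => ∫ x in Ioo a b, ut x t * ψ x) := by
  intro χ hχ hχs
  have hχ' := hχ.smooth_deriv.continuous
  set Z : ℝ → ℝ := fun x => (∫ t in Ioo 0 T, u x t * deriv χ t) + ∫ t in Ioo 0 T, ut x t * χ t
    with hZ
  have iu := integrableOn_mul_slice_left hs.u_int hχ'
  have iut := integrableOn_mul_slice_left hs.ut_int hχ.continuous
  have hZi : IntegrableOn Z (Ioo a b) := iu.add iut
  have key : ∀ φ : ℝ → ℝ, Continuous φ → ∫ x in Ioo a b, Z x * φ x =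
      intOmT a b T (fun x t => u x t * (φ x * deriv χ t)) +
        intOmT a b T (fun x t => ut x t * (φ x * χ t)) := by
    intro φ hφ
    rw [intOmT_mul_tensor_left hs.u_int hφ hχ', intOmT_mul_tensor_left hs.ut_int hφ hχ.continuous,
      ← integral_add (iu.mul_continuous_of_Ioo hφ) (iut.mul_continuous_of_Ioo hφ)]
    simp only [hZ, add_mul]
  have hZ0 := isOpen_Ioo.ae_eq_zero_of_integral_contDiff_smul_eq_zero (μ := volume) (f := Z)
    (U := Ioo a b) hZi.locallyIntegrableOn (fun φ hφ _ hφs => by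
      have h1 := hs.ut_weak (fun x t => φ x * χ t) ⟨contDiff_tensor hφ hχ,
        ⟨tsupport φ, isCompact_tsupport_of_subset_Ioo hφs, hφs, fun x t hx => by
          simp [image_eq_zero_of_notMem_tsupport hx]⟩,
        ⟨tsupport χ, isCompact_tsupport_of_subset_Ioo hχs, hχs, fun x t hx => by
          simp [image_eq_zero_of_notMem_tsupport hx]⟩⟩
      have h2 := key φ hφ.continuous
      rw [pdt_tensor] at h1
      rw [h1, neg_add_cancel] at h2
      rw [← h2, ← integral_indicator measurableSet_Ioo]
      congr 1; ext x
      by_cases hx : x ∈ Ioo a b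
      · simp [hx, mul_comm]
      · have : φ x = 0 := image_eq_zero_of_notMem_tsupport fun hm => hx (hφs hm)
        simp [this, hx])
  have h3 : ∫ x in Ioo a b, Z x * ψ x = 0 := by
    rw [setIntegral_congr_ae (g := fun _ => 0) measurableSet_Ioo
      (hZ0.mono fun x hx hm => by simp [hx hm])]
    simp
  rw [key ψ hψ, intOmT_mul_tensor hs.u_int hψ hχ', intOmT_mul_tensor hs.ut_int hψ hχ.continuous]
    at h3
  linarith

/-- The equations satisfied by the sine coefficients of the displacement. -/
lemma IsWeakSol.integral_mul_sinMode (hab : a < b) (hT : 0 < T)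
    (hd : DataI a b u0 u0x u0t Θ0)
    (hs : IsWeakSol a b T f f' u0 u0t Θ0 u ut ux Θ Θx) (hr : RegT a b T u ut ux Θ Θx) (n : ℕ) :
    IsPrimitiveOn T (∫ x in Ioo a b, u0 x * sinMode a b n x)
      (fun s => ∫ x in Ioo a b, ut x s * sinMode a b n x)
      (fun t => ∫ x in Ioo a b, u x t * sinMode a b n x) ∧
    IsPrimitiveOn T (∫ x in Ioo a b, u0t x * sinMode a b n x)
      (fun s => -(modeFreq a b n * ∫ x in Ioo a b, ux x s * cosMode a b n x) -
        ∫ x in Ioo a b, f' (Θ x s) * Θx x s * sinMode a b n x)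
      (fun t => ∫ x in Ioo a b, ut x t * sinMode a b n x) := by
  have hc := contDiff_sinMode a b n
  have hcc := (contDiff_cosMode a b n).continuous
  have i1 := integrableOn_mul_slice hs.ux_int hcc
  have i2 := integrableOn_mul_slice (F := fun x t => f' (Θ x t) * Θx x t) hs.g1_int hc.continuous
  have i12 := (i1.const_mul (modeFreq a b n)).neg.sub i2
  suffices h : _ ∧ _ from
    ⟨⟨integrableOn_mul_slice hs.ut_int hc.continuous, h.1⟩, ⟨i12, h.2⟩⟩
  refine eq_primitive_of_weak_second hT (hr.u_cont.continuousOn_integral_mul hc.continuous)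
    (hr.ut_cont.continuousOn_integral_mul hc.continuous) i12
    (hs.weakDerivI_integral_mul hc.continuous) ?_
  intro χ hχ hχT
  obtain ⟨T', hT', hχ0⟩ := hχT
  have hχ'' := hχ.smooth_deriv.smooth_deriv.continuous
  have iP := integrableOn_mul_slice_left hs.ux_int hχ.continuous
  have iu := integrableOn_mul_slice_left hs.u_int hχ''
  have ig := integrableOn_mul_slice_left (F := fun x t => f' (Θ x t) * Θx x t) hs.g1_int
    hχ.continuous
  set Q : ℝ → ℝ := fun x => (∫ t in Ioo 0 T, u x t * deriv (deriv χ) t) - u0t x * χ 0 +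
    u0 x * deriv χ 0 + ∫ t in Ioo 0 T, f' (Θ x t) * Θx x t * χ t with hQ
  have i0t := hd.u0t_L2.integrableOn.mul_const (χ 0)
  have i0 := hd.u0_L2.integrableOn.mul_const (deriv χ 0)
  have iQ : IntegrableOn Q (Ioo a b) := ((iu.sub i0t).add i0).add ig
  have key : ∀ φ : ℝ → ℝ, Continuous φ → ∫ x in Ioo a b, Q x * φ x =
      intOmT a b T (fun x t => u x t * (φ x * deriv (deriv χ) t)) -
        (∫ x in Ioo a b, u0t x * φ x) * χ 0 + (∫ x in Ioo a b, u0 x * φ x) * deriv χ 0 +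
        intOmT a b T (fun x t => f' (Θ x t) * Θx x t * (φ x * χ t)) := by
    intro φ hφ
    rw [intOmT_mul_tensor_left hs.u_int hφ hχ'',
      intOmT_mul_tensor_left (F := fun x t => f' (Θ x t) * Θx x t) hs.g1_int hφ hχ.continuous,
      ← integral_mul_const, ← integral_mul_const]
    have k1 := iu.mul_continuous_of_Ioo hφ
    have k2 : IntegrableOn (fun x => u0t x * φ x * χ 0) (Ioo a b) :=
      (hd.u0t_L2.integrableOn.mul_continuous_of_Ioo hφ).mul_const _
    have k3 : IntegrableOn (fun x => u0 x * φ x * deriv χ 0) (Ioo a b) :=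
      (hd.u0_L2.integrableOn.mul_continuous_of_Ioo hφ).mul_const _
    have k4 := ig.mul_continuous_of_Ioo hφ
    have e : ∀ x, Q x * φ x = (∫ t in Ioo 0 T, u x t * deriv (deriv χ) t) * φ x -
        u0t x * φ x * χ 0 + u0 x * φ x * deriv χ 0 +
        (∫ t in Ioo 0 T, f' (Θ x t) * Θx x t * χ t) * φ x := fun x => by
      simp only [hQ]; ring
    simp_rw [e]
    have k12 := k1.sub k2
    have k123 := k12.add k3
    simp only [Pi.add_def, Pi.sub_def] at k12 k123
    rw [integral_add k123 k4, integral_add k12 k3, integral_sub k1 k2]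
  have hPQ : WeakDerivI a b (fun x => ∫ t in Ioo 0 T, ux x t * χ t) Q := by
    intro φ hφ hφs
    have hw := hs.weak_u (fun x t => φ x * χ t) ⟨contDiff_tensor hφ hχ,
      ⟨tsupport φ, isCompact_tsupport_of_subset_Ioo hφs, hφs, fun x t hx => by
        simp [image_eq_zero_of_notMem_tsupport hx]⟩,
      ⟨T', hT', fun x t ht => by simp [hχ0 t ht]⟩⟩
    rw [pdt_tensor, pdt_tensor, pdx_tensor] at hw
    have h1 : intOm a b (fun x => u0t x * (φ x * χ 0)) = (∫ x in Ioo a b, u0t x * φ x) * χ 0 := by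
      rw [intOm, ← integral_mul_const]
      congr 1; ext x; ring
    have h2 : intOm a b (fun x => u0 x * (φ x * deriv χ 0)) =
        (∫ x in Ioo a b, u0 x * φ x) * deriv χ 0 := by
      rw [intOm, ← integral_mul_const]
      congr 1; ext x; ring
    rw [key φ hφ.continuous]
    rw [h1, h2, intOmT_mul_tensor_left hs.ux_int hφ.smooth_deriv.continuous hχ.continuous] at hw
    linarith
  have h1 := hPQ.integral_mul_deriv hab iP iQ hc (sinMode_left a b n) (sinMode_right hab n)
  rw [key _ hc.continuous, ← intOmT_mul_tensor_left hs.ux_int hc.smooth_deriv.continuous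
    hχ.continuous, intOmT_mul_tensor hs.ux_int hc.smooth_deriv.continuous hχ.continuous,
    intOmT_mul_tensor hs.u_int hc.continuous hχ'',
    intOmT_mul_tensor (F := fun x t => f' (Θ x t) * Θx x t) hs.g1_int hc.continuous
      hχ.continuous] at h1
  simp only [integral_mul_deriv_sinMode] at h1
  have j1 := IntegrableOn.mul_continuous_of_Ioo (i1.const_mul (modeFreq a b n)).neg hχ.continuous
  have j2 := i2.mul_continuous_of_Ioo hχ.continuous
  simp only [Pi.neg_apply] at j1
  simp only [sub_mul]
  rw [integral_sub j1 j2]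
  simp only [neg_mul, integral_neg]
  linarith

end Modes

section IsPrimitiveOn

variable {T c c₁ c₂ : ℝ} {r r₁ r₂ z z₁ z₂ : ℝ → ℝ}

lemma integral_congr_of_ae_Ioo {t : ℝ} (ht : t ∈ Icc 0 T)
    (h : ∀ᵐ s ∂volume.restrict (Ioo 0 T), r₁ s = r₂ s) :
    ∫ s in (0 : ℝ)..t, r₁ s = ∫ s in (0 : ℝ)..t, r₂ s := by
  rw [intervalIntegral.integral_of_le ht.1, intervalIntegral.integral_of_le ht.1,
    integral_Ioc_eq_integral_Ioo, integral_Ioc_eq_integral_Ioo]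
  exact integral_congr_ae (ae_restrict_of_ae_restrict_of_subset (Ioo_subset_Ioo_right ht.2) h)

lemma IsPrimitiveOn.intervalIntegrable (h : IsPrimitiveOn T c r z) {t : ℝ} (ht : t ∈ Icc 0 T) :
    IntervalIntegrable r volume 0 t := by
  rw [intervalIntegrable_iff_integrableOn_Ioo_of_le ht.1]
  exact h.1.mono_set (Ioo_subset_Ioo_right ht.2)

lemma IsPrimitiveOn.congr (h : IsPrimitiveOn T c₁ r₁ z₁)
    (hr : ∀ᵐ s ∂volume.restrict (Ioo 0 T), r s = r₁ s) (hz : ∀ t ∈ Icc 0 T, z t = z₁ t)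
    (hc : c = c₁) : IsPrimitiveOn T c r z := by
  refine ⟨h.1.congr (hr.mono fun s hs => hs.symm), fun t ht => ?_⟩
  rw [hz t ht, h.2 t ht, hc, integral_congr_of_ae_Ioo ht hr]

lemma IsPrimitiveOn.add (h₁ : IsPrimitiveOn T c₁ r₁ z₁) (h₂ : IsPrimitiveOn T c₂ r₂ z₂) :
    IsPrimitiveOn T (c₁ + c₂) (fun s => r₁ s + r₂ s) (fun t => z₁ t + z₂ t) := by
  refine ⟨h₁.1.add h₂.1, fun t ht => ?_⟩
  beta_reduce
  rw [intervalIntegral.integral_add (h₁.intervalIntegrable ht) (h₂.intervalIntegrable ht),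
    h₁.2 t ht, h₂.2 t ht]
  ring

lemma IsPrimitiveOn.const_mul (h : IsPrimitiveOn T c r z) (k : ℝ) :
    IsPrimitiveOn T (k * c) (fun s => k * r s) (fun t => k * z t) := by
  refine ⟨Integrable.const_mul h.1 k, fun t ht => ?_⟩
  beta_reduce
  rw [intervalIntegral.integral_const_mul, h.2 t ht]
  ring

lemma IsPrimitiveOn.sub (h₁ : IsPrimitiveOn T c₁ r₁ z₁) (h₂ : IsPrimitiveOn T c₂ r₂ z₂) :
    IsPrimitiveOn T (c₁ - c₂) (fun s => r₁ s - r₂ s) (fun t => z₁ t - z₂ t) :=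
  (h₁.add (h₂.const_mul (-1))).congr (ae_of_all _ fun s => by ring) (fun t _ => by ring) (by ring)

lemma IsPrimitiveOn.sum {ι : Type*} {s : Finset ι} {c : ι → ℝ} {r z : ι → ℝ → ℝ}
    (h : ∀ i, IsPrimitiveOn T (c i) (r i) (z i)) :
    IsPrimitiveOn T (∑ i ∈ s, c i) (fun t => ∑ i ∈ s, r i t) (fun t => ∑ i ∈ s, z i t) := by
  induction s using Finset.cons_induction with
  | empty => exact ⟨by simp, by simp⟩
  | cons i s hi ih =>
    simp only [Finset.sum_cons]
    exact (h i).add ih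

lemma IsPrimitiveOn.sq (hT : 0 < T) (h : IsPrimitiveOn T c r z) :
    IsPrimitiveOn T (c ^ 2) (fun s => 2 * (z s * r s)) (fun t => z t ^ 2) := by
  set w : ℝ → ℝ := fun t => c + ∫ s in (0 : ℝ)..t, r s with hw
  have hr : IntervalIntegrable r volume 0 T := h.intervalIntegrable ⟨hT.le, le_rfl⟩
  have hwc : ContinuousOn w (Icc 0 T) := by
    simpa [uIcc_of_le hT.le] using (absolutelyContinuousOnInterval_primitive hr c).continuousOn
  have hi : IntegrableOn (fun s => r s * w s) (Icc 0 T) :=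
    IntegrableOn.mul_continuousOn ((integrableOn_Icc_iff_integrableOn_Ioo).mpr h.1) hwc
      isCompact_Icc
  have hi2 : IntegrableOn (fun s => 2 * (w s * r s)) (Ioo 0 T) := by
    have : IntegrableOn (fun s => 2 * (r s * w s)) (Ioo 0 T) :=
      Integrable.const_mul (hi.mono_set Ioo_subset_Icc_self) 2
    simpa only [mul_comm (r _) (w _)] using this
  have hp : IsPrimitiveOn T (c ^ 2) (fun s => 2 * (w s * r s)) (fun t => w t ^ 2) := by
    refine ⟨hi2, fun t ht => ?_⟩
    have := primitive_sq_sub (h.intervalIntegrable ht) c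
    simp only [hw]
    linarith
  refine hp.congr ?_ (fun t ht => by rw [h.2 t ht]) rfl
  filter_upwards [ae_restrict_mem measurableSet_Ioo] with s hs
  rw [h.2 s (Ioo_subset_Icc_self hs)]

end IsPrimitiveOn

/-- Uniform bounds for the nonlinearity on nonnegative arguments. -/
structure NonlinBound (f f' : ℝ → ℝ) (M : ℝ) : Prop where
  nonneg : 0 ≤ M
  deriv_le : ∀ x, 0 ≤ x → |f' x| ≤ M
  le : ∀ x, 0 ≤ x → |f x| ≤ M * |x|
  sub_le : ∀ x y, 0 ≤ x → 0 ≤ y → |f x - f y| ≤ M * |x - y|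
  deriv_sub_le : ∀ x y, 0 ≤ x → 0 ≤ y → |f' x - f' y| ≤ M * |x - y|

lemma HypF.exists_nonlinBound {f f' f'' : ℝ → ℝ} (hf : HypF f f' f'') :
    ∃ M, NonlinBound f f' M := by
  obtain ⟨M, hM⟩ := hf.bdd
  have h1 : ∀ x y : ℝ, 0 ≤ x → 0 ≤ y → |f x - f y| ≤ M * |x - y| := fun x y hx hy =>
    (convex_Ici 0).norm_image_sub_le_of_norm_hasDerivWithin_le hf.hasDeriv₁
      (fun z hz => (hM z hz).1) hy hx
  refine ⟨M, (abs_nonneg _).trans (hM 0 self_mem_Ici).1, fun x hx => (hM x hx).1, ?_, h1, ?_⟩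
  · intro x hx
    simpa [hf.zero] using h1 x 0 hx le_rfl
  · intro x y hx hy
    exact (convex_Ici 0).norm_image_sub_le_of_norm_hasDerivWithin_le hf.hasDeriv₂
      (fun z hz => (hM z hz).2) hy hx

/-- Regularity of a spatial slice of a solution. -/
structure SliceReg (a b : ℝ) (f f' v θ θx : ℝ → ℝ) : Prop where
  v_L2 : MemL2 a b v
  θ_L2 : MemL2 a b θ
  θx_L2 : MemL2 a b θx
  weak : WeakDerivI a b θ θx
  nonneg : ∀ᵐ x ∂volume.restrict (Ioo a b), 0 ≤ θ x
  g1_int : IntegrableOn (fun x => f' (θ x) * θx x) (Ioo a b)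
  g2_int : IntegrableOn (fun x => f' (θ x) * θx x * v x) (Ioo a b)
  g3_int : IntegrableOn (fun x => f (θ x) * v x) (Ioo a b)

lemma WeakDerivI.sub {a b : ℝ} {g g' h h' : ℝ → ℝ} (hg : WeakDerivI a b g g')
    (hh : WeakDerivI a b h h') (ig : IntegrableOn g (Ioo a b)) (ig' : IntegrableOn g' (Ioo a b))
    (ih : IntegrableOn h (Ioo a b)) (ih' : IntegrableOn h' (Ioo a b)) :
    WeakDerivI a b (fun x => g x - h x) (fun x => g' x - h' x) := by
  intro ψ hψ hs
  have c1 := hψ.continuous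
  have c2 := hψ.smooth_deriv.continuous
  simp only [sub_mul]
  rw [integral_sub (ig.mul_continuous_of_Ioo c2) (ih.mul_continuous_of_Ioo c2),
    integral_sub (ig'.mul_continuous_of_Ioo c1) (ih'.mul_continuous_of_Ioo c1), hg ψ hψ hs,
    hh ψ hψ hs]
  ring

lemma sum_modeWeight_le {a b : ℝ} (hab : a < b) (N : ℕ) {p q : ℕ → ℝ} {P Q : ℝ}
    (hp : ∑ n ∈ Finset.range N, modeWeight a b n * p n ^ 2 ≤ P)
    (hq : ∑ n ∈ Finset.range N, modeWeight a b n * q n ^ 2 ≤ Q) :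
    |∑ n ∈ Finset.range N, modeWeight a b n * (p n * q n)| ≤ √P * √Q := by
  have hw := modeWeight_pos hab
  have h1 := Finset.sum_mul_sq_le_sq_mul_sq (Finset.range N)
    (fun n => √(modeWeight a b n) * p n) (fun n => √(modeWeight a b n) * q n)
  simp only [mul_pow, Real.sq_sqrt (hw _).le] at h1
  have h2 : ∀ n, √(modeWeight a b n) * p n * (√(modeWeight a b n) * q n) =
      modeWeight a b n * (p n * q n) := fun n => by
    rw [mul_mul_mul_comm, Real.mul_self_sqrt (hw n).le]
  simp only [h2] at h1
  have h3 : 0 ≤ ∑ n ∈ Finset.range N, modeWeight a b n * p n ^ 2 :=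
    Finset.sum_nonneg fun n _ => mul_nonneg (hw n).le (sq_nonneg _)
  have h4 : 0 ≤ ∑ n ∈ Finset.range N, modeWeight a b n * q n ^ 2 :=
    Finset.sum_nonneg fun n _ => mul_nonneg (hw n).le (sq_nonneg _)
  rw [← Real.sqrt_mul (h3.trans hp)]
  apply Real.abs_le_sqrt
  exact h1.trans (mul_le_mul hp hq h4 (h3.trans hp))

lemma sum_sinMode_le {a b : ℝ} (hab : a < b) (N : ℕ) {g : ℝ → ℝ} (hg : MemL2 a b g) :
    ∑ n ∈ Finset.range N, modeWeight a b n * (∫ x in Ioo a b, g x * sinMode a b n x) ^ 2 ≤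
      sqOm a b g :=
  sum_le_hasSum _ (fun n _ => mul_nonneg (modeWeight_pos hab n).le (sq_nonneg _))
    (hasSum_sinMode hab hg)

lemma sum_cosMode_le {a b : ℝ} (hab : a < b) (N : ℕ) {g : ℝ → ℝ} (hg : MemL2 a b g) :
    ∑ n ∈ Finset.range N, modeWeight a b n * (∫ x in Ioo a b, g x * cosMode a b n x) ^ 2 ≤
      sqOm a b g :=
  sum_le_hasSum _ (fun n _ => mul_nonneg (modeWeight_pos hab n).le (sq_nonneg _))
    (hasSum_cosMode hab hg)

lemma sqOm_sum_cosMode {a b : ℝ} (hab : a < b) (N : ℕ) (c : ℕ → ℝ) :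
    sqOm a b (fun x => ∑ n ∈ Finset.range N, modeWeight a b n * (c n * cosMode a b n x)) =
      ∑ n ∈ Finset.range N, modeWeight a b n * c n ^ 2 := by
  have hcc : ∀ n, Continuous (cosMode a b n) := fun n => (contDiff_cosMode a b n).continuous
  have e : ∀ x, (∑ n ∈ Finset.range N, modeWeight a b n * (c n * cosMode a b n x)) ^ 2 =
      ∑ n ∈ Finset.range N, ∑ m ∈ Finset.range N,
        modeWeight a b n * c n * (modeWeight a b m * c m) * (cosMode a b n x * cosMode a b m x) := by
    intro x
    rw [sq, Finset.sum_mul_sum]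
    exact Finset.sum_congr rfl fun n _ => Finset.sum_congr rfl fun m _ => by ring
  have hi : ∀ n m, IntegrableOn (fun x => modeWeight a b n * c n * (modeWeight a b m * c m) *
      (cosMode a b n x * cosMode a b m x)) (Ioo a b) := fun n m =>
    (((hcc n).mul (hcc m)).const_mul _).memL2.integrableOn
  rw [sqOm]
  simp_rw [e]
  rw [integral_finsetSum _ fun n _ => integrable_finsetSum _ fun m _ => hi n m]
  refine Finset.sum_congr rfl fun n hn => ?_
  rw [integral_finsetSum _ fun m _ => hi n m]
  simp_rw [integral_const_mul, integral_cosMode_mul_cosMode hab]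
  rw [Finset.sum_eq_single n (fun m _ hm => by simp [hm.symm]) (fun h => absurd hn h)]
  have := (modeWeight_pos hab n).ne'
  simp only [if_true]
  field_simp

lemma sqOm_sum_sinMode_le {a b : ℝ} (hab : a < b) (N : ℕ) (c : ℕ → ℝ) :
    sqOm a b (fun x => ∑ n ∈ Finset.range N, modeWeight a b n * (c n * sinMode a b n x)) ≤
      ∑ n ∈ Finset.range N, modeWeight a b n * c n ^ 2 := by
  have hcc : ∀ n, Continuous (sinMode a b n) := fun n => (contDiff_sinMode a b n).continuous
  have e : ∀ x, (∑ n ∈ Finset.range N, modeWeight a b n * (c n * sinMode a b n x)) ^ 2 =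
      ∑ n ∈ Finset.range N, ∑ m ∈ Finset.range N,
        modeWeight a b n * c n * (modeWeight a b m * c m) * (sinMode a b n x * sinMode a b m x) := by
    intro x
    rw [sq, Finset.sum_mul_sum]
    exact Finset.sum_congr rfl fun n _ => Finset.sum_congr rfl fun m _ => by ring
  have hi : ∀ n m, IntegrableOn (fun x => modeWeight a b n * c n * (modeWeight a b m * c m) *
      (sinMode a b n x * sinMode a b m x)) (Ioo a b) := fun n m =>
    (((hcc n).mul (hcc m)).const_mul _).memL2.integrableOn
  rw [sqOm]
  simp_rw [e]
  rw [integral_finsetSum _ fun n _ => integrable_finsetSum _ fun m _ => hi n m]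
  refine Finset.sum_le_sum fun n hn => ?_
  rw [integral_finsetSum _ fun m _ => hi n m]
  simp_rw [integral_const_mul, integral_sinMode_mul_sinMode hab]
  rw [Finset.sum_eq_single n (fun m _ hm => by simp [hm.symm]) (fun h => absurd hn h)]
  have hw := modeWeight_pos hab n
  split_ifs
  · apply le_of_eq; field_simp
  · rw [mul_zero]; positivity

/-- Partial cosine sums of an `H¹` function paired with an integrable function. -/
lemma abs_sum_cosMode_mul_le {a b : ℝ} (hab : a < b) {θ θx G : ℝ → ℝ} (hθ : MemL2 a b θ)
    (hθx : MemL2 a b θx) (hw : WeakDerivI a b θ θx) (hG : IntegrableOn G (Ioo a b)) (N : ℕ) :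
    |∑ n ∈ Finset.range N, modeWeight a b n *
      ((∫ x in Ioo a b, θ x * cosMode a b n x) * ∫ x in Ioo a b, G x * cosMode a b n x)| ≤
    √((b - a)⁻¹ * sqOm a b θ + 2 * √(sqOm a b θ) * √(sqOm a b θx)) * ∫ x in Ioo a b, |G x| := by
  have hL : 0 < b - a := by linarith
  set c : ℕ → ℝ := fun n => ∫ x in Ioo a b, θ x * cosMode a b n x with hc
  set P : ℝ → ℝ := fun x => ∑ n ∈ Finset.range N, modeWeight a b n * (c n * cosMode a b n x)
    with hP
  set P' : ℝ → ℝ := fun x => ∑ n ∈ Finset.range N, modeWeight a b n *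
    ((∫ y in Ioo a b, θx y * sinMode a b n y) * sinMode a b n x) with hP'
  have hcc : ∀ n, Continuous (cosMode a b n) := fun n => (contDiff_cosMode a b n).continuous
  have hsc : ∀ n, Continuous (sinMode a b n) := fun n => (contDiff_sinMode a b n).continuous
  have hPc : Continuous P := continuous_finsetSum _ fun n _ =>
    ((hcc n).const_mul _).const_mul _
  have hP'c : Continuous P' := continuous_finsetSum _ fun n _ =>
    ((hsc n).const_mul _).const_mul _
  have hPd : ∀ x, HasDerivAt P (P' x) x := by
    intro x
    refine HasDerivAt.fun_sum fun n _ => ?_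
    refine (((hasDerivAt_cosMode a b n x).const_mul (c n)).const_mul
      (modeWeight a b n)).congr_deriv ?_
    rw [hw.integral_mul_sinMode hab hθ.integrableOn hθx.integrableOn]
    ring
  have hPP' : ∀ x, P x = P a + ∫ s in a..x, P' s := fun x => by
    rw [intervalIntegral.integral_eq_sub_of_hasDerivAt (fun y _ => hPd y)
      (hP'c.intervalIntegrable _ _)]
    ring
  have hB : ∀ x ∈ Icc a b,
      |P x| ≤ √((b - a)⁻¹ * sqOm a b θ + 2 * √(sqOm a b θ) * √(sqOm a b θx)) := by
    intro x hx
    apply Real.abs_le_sqrt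
    have h1 := hP'c.memL2.sqOm_primitive_le hab (P a) hx
    simp only [← hPP'] at h1
    have h2 : sqOm a b P ≤ sqOm a b θ := by
      rw [hP, sqOm_sum_cosMode hab]
      exact sum_cosMode_le hab N hθ
    have h3 : sqOm a b P' ≤ sqOm a b θx :=
      (sqOm_sum_sinMode_le hab N _).trans (sum_sinMode_le hab N hθx)
    have h4 := Real.sqrt_le_sqrt h2
    have h5 := Real.sqrt_le_sqrt h3
    refine h1.trans ?_
    gcongr
  have hsum : ∑ n ∈ Finset.range N, modeWeight a b n *
      (c n * ∫ x in Ioo a b, G x * cosMode a b n x) = ∫ x in Ioo a b, P x * G x := by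
    simp_rw [hP, Finset.sum_mul]
    rw [integral_finsetSum _ fun n _ => ?_]
    · refine Finset.sum_congr rfl fun n _ => ?_
      rw [← integral_const_mul, ← integral_const_mul]
      congr 1; ext x; ring
    · have : IntegrableOn (fun x => G x * (modeWeight a b n * (c n * cosMode a b n x))) (Ioo a b) :=
        hG.mul_continuous_of_Ioo (((hcc n).const_mul (c n)).const_mul (modeWeight a b n))
      have e : (fun x => modeWeight a b n * (c n * cosMode a b n x) * G x) =
          fun x => G x * (modeWeight a b n * (c n * cosMode a b n x)) := by ext x; ring
      rw [e]
      exact this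
  rw [hsum, ← integral_const_mul]
  refine (abs_integral_le_integral_abs).trans ?_
  refine setIntegral_mono_on ?_ (hG.abs.const_mul _) measurableSet_Ioo fun x hx => ?_
  · have : IntegrableOn (fun x => |G x * P x|) (Ioo a b) := (hG.mul_continuous_of_Ioo hPc).abs
    simpa only [mul_comm (G _)] using this
  · rw [abs_mul]
    exact mul_le_mul_of_nonneg_right (hB x (Ioo_subset_Icc_self hx)) (abs_nonneg _)

/-- The coefficient in the Gronwall estimate for differences of solutions. -/
def gronwallCoeff (K M A : ℝ) : ℝ :=
  5 * M ^ 2 + 4 * M ^ 2 * K * A ^ 2 + 8 * M ^ 2 * A + K + 16 +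
    16 * M ^ 2 * A ^ 2 * K + 4096 * M ^ 4 * A ^ 4 + M * A * K + 16 * M ^ 2 * A ^ 2

lemma gronwallCoeff_nonneg {K M A : ℝ} (hK : 0 ≤ K) (hM : 0 ≤ M) (hA : 0 ≤ A) :
    0 ≤ gronwallCoeff K M A := by
  rw [gronwallCoeff]
  positivity

lemma young_bound {D V X h A B m M K : ℝ} (hh : 0 ≤ h) (hA : 0 ≤ A) (hM : 0 ≤ M) (hK : 0 ≤ K)
    (hB2 : B ^ 2 ≤ K * X ^ 2 + 2 * X * D) (hm2 : m ^ 2 ≤ K * A ^ 2 + 2 * A * h) :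
    (M * D + M * B * h) * V + B * ((M * D + M * B * h) * A + M * h * V) +
      D * (M * B * A + M * m * V) ≤
    1 / 2 * D ^ 2 + gronwallCoeff K M A * (1 + h ^ 2) * (X ^ 2 + V ^ 2) := by
  rw [gronwallCoeff]
  have t1 : M * D * V ≤ D ^ 2 / 16 + 4 * M ^ 2 * V ^ 2 := by nlinarith [sq_nonneg (D / 4 - 2 * M * V)]
  have t2 : 2 * M * B * h * V ≤ B ^ 2 + M ^ 2 * h ^ 2 * V ^ 2 := by nlinarith [sq_nonneg (B - M * h * V)]
  have t2' : 2 * X * D ≤ 16 * X ^ 2 + D ^ 2 / 16 := by nlinarith [sq_nonneg (4 * X - D / 4)]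
  have t3 : 2 * M * A * B * D ≤ D ^ 2 / 16 + 16 * M ^ 2 * A ^ 2 * B ^ 2 := by
    nlinarith [sq_nonneg (D / 4 - 4 * M * A * B)]
  have t3' : 16 * M ^ 2 * A ^ 2 * (2 * X * D) ≤ D ^ 2 / 16 + 4096 * M ^ 4 * A ^ 4 * X ^ 2 := by
    nlinarith [sq_nonneg (D / 4 - 64 * M ^ 2 * A ^ 2 * X)]
  have t3'' := mul_le_mul_of_nonneg_left hB2 (show 0 ≤ 16 * M ^ 2 * A ^ 2 by positivity)
  have t4 := mul_le_mul_of_nonneg_left hB2 (show 0 ≤ M * A * h by positivity)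
  have t4' : M * A * h * (2 * X * D) ≤ D ^ 2 / 16 + 16 * M ^ 2 * A ^ 2 * h ^ 2 * X ^ 2 := by
    nlinarith [sq_nonneg (D / 4 - 4 * M * A * h * X)]
  have t5 : M * m * V * D ≤ D ^ 2 / 16 + 4 * M ^ 2 * V ^ 2 * m ^ 2 := by
    nlinarith [sq_nonneg (D / 4 - 2 * M * m * V)]
  have t5' := mul_le_mul_of_nonneg_left hm2 (show 0 ≤ 4 * M ^ 2 * V ^ 2 by positivity)
  have hh2 : h ≤ 1 + h ^ 2 := by nlinarith [sq_nonneg (h - 1)]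
  have t6 : M * A * K * X ^ 2 * h ≤ M * A * K * X ^ 2 * (1 + h ^ 2) :=
    mul_le_mul_of_nonneg_left hh2 (by positivity)
  have t7 : 8 * M ^ 2 * A * V ^ 2 * h ≤ 8 * M ^ 2 * A * V ^ 2 * (1 + h ^ 2) :=
    mul_le_mul_of_nonneg_left hh2 (by positivity)
  have hfin : (4 * M ^ 2 + M ^ 2 * h ^ 2 + 4 * M ^ 2 * K * A ^ 2) * V ^ 2 +
      8 * M ^ 2 * A * V ^ 2 * (1 + h ^ 2) + (K + 16 + 16 * M ^ 2 * A ^ 2 * K +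
      4096 * M ^ 4 * A ^ 4 + 16 * M ^ 2 * A ^ 2 * h ^ 2) * X ^ 2 +
      M * A * K * X ^ 2 * (1 + h ^ 2) ≤
      (5 * M ^ 2 + 4 * M ^ 2 * K * A ^ 2 + 8 * M ^ 2 * A + K + 16 +
      16 * M ^ 2 * A ^ 2 * K + 4096 * M ^ 4 * A ^ 4 + M * A * K + 16 * M ^ 2 * A ^ 2) *
      (1 + h ^ 2) * (X ^ 2 + V ^ 2) := by
    rw [← sub_nonneg]
    ring_nf
    positivity
  nlinarith

lemma sqrt_sqOm_const_mul {a b : ℝ} {c : ℝ} (hc : 0 ≤ c) (g : ℝ → ℝ) :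
    √(sqOm a b (fun x => c * g x)) = c * √(sqOm a b g) := by
  have : sqOm a b (fun x => c * g x) = c ^ 2 * sqOm a b g := by
    rw [sqOm, sqOm, ← integral_const_mul]
    congr 1; ext x; ring
  rw [this, Real.sqrt_mul (sq_nonneg c), Real.sqrt_sq hc]

lemma MemL2.const_mul {a b : ℝ} {g : ℝ → ℝ} (hg : MemL2 a b g) (c : ℝ) :
    MemL2 a b (fun x => c * g x) :=
  (hg.memLp.const_mul c).memL2

lemma MemL2.of_abs_le {a b : ℝ} {g p q : ℝ → ℝ} (hp : MemL2 a b p) (hq : MemL2 a b q)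
    (hm : AEStronglyMeasurable g (volume.restrict (Ioo a b)))
    (hg : ∀ᵐ x ∂volume.restrict (Ioo a b), |g x| ≤ |p x| + |q x|) : MemL2 a b g := by
  refine MemLp.memL2 ((hp.memLp.abs.add hq.memLp.abs).mono hm ?_)
  filter_upwards [hg] with x hx
  rw [Real.norm_eq_abs, Real.norm_eq_abs]
  exact hx.trans (le_abs_self _)

/-- The nonlinear terms in the energy identity for a difference of two solutions, projected on
finitely many modes, are controlled by the dissipation and the energy. -/
lemma SliceReg.sum_le {a b : ℝ} (hab : a < b) {f f' : ℝ → ℝ} {M A : ℝ} (hf : NonlinBound f f' M)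
    (hA : 0 ≤ A) {v₁ θ₁ θx₁ v₂ θ₂ θx₂ : ℝ → ℝ} (h₁ : SliceReg a b f f' v₁ θ₁ θx₁)
    (h₂ : SliceReg a b f f' v₂ θ₂ θx₂) (hv : √(sqOm a b v₁) ≤ A) (hθ : √(sqOm a b θ₂) ≤ A)
    (N : ℕ) :
    ∑ n ∈ Finset.range N, modeWeight a b n *
      (-((∫ x in Ioo a b, (f' (θ₁ x) * θx₁ x - f' (θ₂ x) * θx₂ x) * sinMode a b n x) *
          ∫ x in Ioo a b, (v₁ x - v₂ x) * sinMode a b n x) +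
        (∫ x in Ioo a b, (θ₁ x - θ₂ x) * cosMode a b n x) *
          (∫ x in Ioo a b, (f' (θ₁ x) * θx₁ x * v₁ x - f' (θ₂ x) * θx₂ x * v₂ x) *
            cosMode a b n x) +
        (∫ x in Ioo a b, (θx₁ x - θx₂ x) * sinMode a b n x) *
          ∫ x in Ioo a b, (f (θ₁ x) * v₁ x - f (θ₂ x) * v₂ x) * sinMode a b n x) ≤
    1 / 2 * sqOm a b (fun x => θx₁ x - θx₂ x) +
      gronwallCoeff (b - a)⁻¹ M A * (1 + sqOm a b θx₂) *
      (sqOm a b (fun x => θ₁ x - θ₂ x) + sqOm a b (fun x => v₁ x - v₂ x)) := by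
  have hM := hf.nonneg
  have hK : 0 ≤ (b - a)⁻¹ := inv_nonneg.mpr (by linarith)
  have hvL := h₁.v_L2.sub h₂.v_L2
  have hθL := h₁.θ_L2.sub h₂.θ_L2
  have hθxL := h₁.θx_L2.sub h₂.θx_L2
  have hw := h₁.weak.sub h₂.weak h₁.θ_L2.integrableOn h₁.θx_L2.integrableOn
    h₂.θ_L2.integrableOn h₂.θx_L2.integrableOn
  set D := √(sqOm a b (fun x => θx₁ x - θx₂ x)) with hD
  set V := √(sqOm a b (fun x => v₁ x - v₂ x)) with hV
  set X := √(sqOm a b (fun x => θ₁ x - θ₂ x)) with hX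
  set h := √(sqOm a b θx₂) with hh
  have hD2 : sqOm a b (fun x => θx₁ x - θx₂ x) = D ^ 2 := (Real.sq_sqrt (sqOm_nonneg _ _ _)).symm
  have hV2 : sqOm a b (fun x => v₁ x - v₂ x) = V ^ 2 := (Real.sq_sqrt (sqOm_nonneg _ _ _)).symm
  have hX2 : sqOm a b (fun x => θ₁ x - θ₂ x) = X ^ 2 := (Real.sq_sqrt (sqOm_nonneg _ _ _)).symm
  have hh2 : sqOm a b θx₂ = h ^ 2 := (Real.sq_sqrt (sqOm_nonneg _ _ _)).symm
  have hD0 : 0 ≤ D := Real.sqrt_nonneg _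
  have hV0 : 0 ≤ V := Real.sqrt_nonneg _
  have hX0 : 0 ≤ X := Real.sqrt_nonneg _
  have hh0 : 0 ≤ h := Real.sqrt_nonneg _
  set B := √((b - a)⁻¹ * X ^ 2 + 2 * X * D) with hB
  set m := √((b - a)⁻¹ * A ^ 2 + 2 * A * h) with hm
  have hB0 : 0 ≤ B := Real.sqrt_nonneg _
  have hm0 : 0 ≤ m := Real.sqrt_nonneg _
  have hB2 : B ^ 2 = (b - a)⁻¹ * X ^ 2 + 2 * X * D := Real.sq_sqrt (by positivity)
  have hm2 : m ^ 2 = (b - a)⁻¹ * A ^ 2 + 2 * A * h := Real.sq_sqrt (by positivity)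
  have hθB : ∀ᵐ x ∂volume.restrict (Ioo a b), |θ₁ x - θ₂ x| ≤ B := by
    filter_upwards [hw.sq_le hab hθL hθxL] with x hx
    rw [hX2, hD2, Real.sqrt_sq hX0, Real.sqrt_sq hD0] at hx
    exact Real.abs_le_sqrt hx
  have hθm : ∀ᵐ x ∂volume.restrict (Ioo a b), |θ₂ x| ≤ m := by
    filter_upwards [h₂.weak.sq_le hab h₂.θ_L2 h₂.θx_L2] with x hx
    refine Real.abs_le_sqrt (hx.trans ?_)
    have : sqOm a b θ₂ ≤ A ^ 2 := (Real.sqrt_le_left hA).mp hθ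
    gcongr
  -- the difference of the gradients of the nonlinearity
  have hg_le : ∀ᵐ x ∂volume.restrict (Ioo a b),
      |f' (θ₁ x) * θx₁ x - f' (θ₂ x) * θx₂ x| ≤
        |M * (θx₁ x - θx₂ x)| + |M * B * θx₂ x| := by
    filter_upwards [h₁.nonneg, h₂.nonneg, hθB] with x h1 h2 h3
    have e : f' (θ₁ x) * θx₁ x - f' (θ₂ x) * θx₂ x =
      f' (θ₁ x) * (θx₁ x - θx₂ x) + (f' (θ₁ x) - f' (θ₂ x)) * θx₂ x := by ring
    rw [e]
    refine (abs_add_le _ _).trans ?_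
    rw [abs_mul, abs_mul, abs_mul, abs_mul (M * B), abs_of_nonneg hM,
      abs_of_nonneg (mul_nonneg hM hB0)]
    have h4 := hf.deriv_le _ h1
    have h5 := (hf.deriv_sub_le _ _ h1 h2).trans (mul_le_mul_of_nonneg_left h3 hM)
    gcongr
  have hgL : MemL2 a b (fun x => f' (θ₁ x) * θx₁ x - f' (θ₂ x) * θx₂ x) := (hθxL.const_mul M).of_abs_le (h₂.θx_L2.const_mul (M * B))
    (h₁.g1_int.1.sub h₂.g1_int.1) hg_le
  have hgn := sqrt_sqOm_le_add (hθxL.const_mul M) (h₂.θx_L2.const_mul (M * B)) hg_le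
  rw [sqrt_sqOm_const_mul hM, sqrt_sqOm_const_mul (mul_nonneg hM hB0)] at hgn
  -- the difference of the heat sources
  have hG1i : IntegrableOn (fun x => f' (θ₁ x) * θx₁ x * v₁ x - f' (θ₂ x) * θx₂ x * v₂ x)
      (Ioo a b) := h₁.g2_int.sub h₂.g2_int
  have hG1 : ∫ x in Ioo a b, |f' (θ₁ x) * θx₁ x * v₁ x - f' (θ₂ x) * θx₂ x * v₂ x| ≤
      (M * D + M * B * h) * A + M * h * V := by
    have i1 : IntegrableOn (fun x => |f' (θ₁ x) * θx₁ x - f' (θ₂ x) * θx₂ x| * |v₁ x|)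
        (Ioo a b) := hgL.memLp.abs.memL2.mul_integrableOn h₁.v_L2.memLp.abs.memL2
    have i2 : IntegrableOn (fun x => |M * θx₂ x| * |v₁ x - v₂ x|) (Ioo a b) :=
      (h₂.θx_L2.const_mul M).memLp.abs.memL2.mul_integrableOn hvL.memLp.abs.memL2
    have j1 := hgL.integral_abs_mul_le h₁.v_L2
    have j2 := (h₂.θx_L2.const_mul M).integral_abs_mul_le hvL
    rw [sqrt_sqOm_const_mul hM] at j2
    have k1 := integral_mono_ae hG1i.abs (i1.add i2) (by
      filter_upwards [h₂.nonneg] with x h2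
      simp only [Pi.add_apply]
      have e : f' (θ₁ x) * θx₁ x * v₁ x - f' (θ₂ x) * θx₂ x * v₂ x =
        (f' (θ₁ x) * θx₁ x - f' (θ₂ x) * θx₂ x) * v₁ x +
          f' (θ₂ x) * θx₂ x * (v₁ x - v₂ x) := by ring
      rw [e]
      refine (abs_add_le _ _).trans ?_
      rw [abs_mul, abs_mul (f' (θ₂ x) * θx₂ x), abs_mul (f' (θ₂ x)), abs_mul M, abs_of_nonneg hM]
      have h4 := hf.deriv_le _ h2
      gcongr)
    simp only [Pi.add_apply] at k1
    rw [integral_add i1 i2] at k1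
    have j3 : √(sqOm a b (fun x => f' (θ₁ x) * θx₁ x - f' (θ₂ x) * θx₂ x)) * √(sqOm a b v₁) ≤
        (M * D + M * B * h) * A := by gcongr
    linarith
  -- the difference of the heat fluxes
  have hG2_le : ∀ᵐ x ∂volume.restrict (Ioo a b), |f (θ₁ x) * v₁ x - f (θ₂ x) * v₂ x| ≤
      |M * B * v₁ x| + |M * m * (v₁ x - v₂ x)| := by
    filter_upwards [h₁.nonneg, h₂.nonneg, hθB, hθm] with x h1 h2 h3 h4
    have e : f (θ₁ x) * v₁ x - f (θ₂ x) * v₂ x =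
      (f (θ₁ x) - f (θ₂ x)) * v₁ x + f (θ₂ x) * (v₁ x - v₂ x) := by ring
    rw [e]
    refine (abs_add_le _ _).trans ?_
    rw [abs_mul, abs_mul, abs_mul (M * B), abs_mul (M * m), abs_of_nonneg (mul_nonneg hM hm0),
      abs_of_nonneg (mul_nonneg hM hB0)]
    have h5 := (hf.le _ h2).trans (mul_le_mul_of_nonneg_left h4 hM)
    have h6 := (hf.sub_le _ _ h1 h2).trans (mul_le_mul_of_nonneg_left h3 hM)
    gcongr
  have hG2L : MemL2 a b (fun x => f (θ₁ x) * v₁ x - f (θ₂ x) * v₂ x) := (h₁.v_L2.const_mul (M * B)).of_abs_le (hvL.const_mul (M * m))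
    (h₁.g3_int.1.sub h₂.g3_int.1) hG2_le
  have hG2n := sqrt_sqOm_le_add (h₁.v_L2.const_mul (M * B)) (hvL.const_mul (M * m)) hG2_le
  rw [sqrt_sqOm_const_mul (mul_nonneg hM hm0), sqrt_sqOm_const_mul (mul_nonneg hM hB0)] at hG2n
  have s1 := sum_modeWeight_le hab N (sum_sinMode_le hab N hgL) (sum_sinMode_le hab N hvL)
  have s2 := abs_sum_cosMode_mul_le hab hθL hθxL hw hG1i N
  have s3 := sum_modeWeight_le hab N (sum_sinMode_le hab N hθxL) (sum_sinMode_le hab N hG2L)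
  rw [← hX, ← hD, hX2, ← hB] at s2
  simp only [mul_add, mul_neg, Finset.sum_add_distrib, Finset.sum_neg_distrib]
  rw [hX2, hV2, hD2, hh2]
  have y := young_bound (D := D) (V := V) (B := B) (m := m) hh0 hA hM hK hB2.le hm2.le
  have u1 : √(sqOm a b (fun x => f' (θ₁ x) * θx₁ x - f' (θ₂ x) * θx₂ x)) * V ≤
      (M * D + M * B * h) * V := by gcongr
  have u2 := mul_le_mul_of_nonneg_left hG1 hB0
  have u3 : D * √(sqOm a b (fun x => f (θ₁ x) * v₁ x - f (θ₂ x) * v₂ x)) ≤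
      D * (M * B * A + M * m * V) := by
    gcongr
    refine hG2n.trans ?_
    gcongr
  have r1 := (abs_le.mp s1).1
  have r2 := (abs_le.mp s2).2
  have r3 := (abs_le.mp s3).2
  linarith

lemma integral_sub_mul {a b : ℝ} {p q ψ : ℝ → ℝ} (hp : IntegrableOn p (Ioo a b))
    (hq : IntegrableOn q (Ioo a b)) (hψ : Continuous ψ) :
    ∫ x in Ioo a b, (p x - q x) * ψ x =
      (∫ x in Ioo a b, p x * ψ x) - ∫ x in Ioo a b, q x * ψ x := by
  simp only [sub_mul]
  exact integral_sub (hp.mul_continuous_of_Ioo hψ) (hq.mul_continuous_of_Ioo hψ)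

lemma ContL2.sub {a b : ℝ} {J : Set ℝ} {w z : ℝ → ℝ → ℝ} (hw : ContL2 a b J w)
    (hz : ContL2 a b J z) : ContL2 a b J (fun x t => w x t - z x t) := by
  refine ⟨fun t ht => (hw.1 t ht).sub (hz.1 t ht), fun t₀ ht₀ => ?_⟩
  have h1 : Tendsto (fun t => (√(sqOm a b (fun x => w x t - w x t₀)) +
      √(sqOm a b (fun x => z x t - z x t₀))) ^ 2) (nhdsWithin t₀ J) (nhds 0) := by
    simpa only [sqOm, Real.sqrt_zero, add_zero, ne_eq, OfNat.ofNat_ne_zero, not_false_eq_true,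
      zero_pow] using (((hw.2 t₀ ht₀).sqrt).add ((hz.2 t₀ ht₀).sqrt)).pow 2
  refine tendsto_of_tendsto_of_tendsto_of_le_of_le' tendsto_const_nhds h1
    (Eventually.of_forall fun t => sqOm_nonneg _ _ _) ?_
  filter_upwards [self_mem_nhdsWithin] with t ht
  refine (Real.sqrt_le_left (by positivity)).mp (sqrt_sqOm_le_add
    ((hw.1 t ht).sub (hw.1 t₀ ht₀)) ((hz.1 t ht).sub (hz.1 t₀ ht₀)) (ae_of_all _ fun x => ?_))
  have : w x t - z x t - (w x t₀ - z x t₀) = (w x t - w x t₀) - (z x t - z x t₀) := by ring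
  rw [this]
  exact abs_sub _ _

lemma ContL2.continuousOn_sqOm {a b : ℝ} {J : Set ℝ} {w : ℝ → ℝ → ℝ} (hw : ContL2 a b J w) :
    ContinuousOn (fun t => sqOm a b (fun x => w x t)) J := by
  have h : ContinuousOn (fun t => √(sqOm a b (fun x => w x t))) J := by
    intro t₀ ht₀
    rw [ContinuousWithinAt, tendsto_iff_dist_tendsto_zero]
    have h1 : Tendsto (fun t => √(sqOm a b (fun x => w x t - w x t₀))) (nhdsWithin t₀ J)
        (nhds 0) := by
      simpa only [sqOm, Real.sqrt_zero] using (hw.2 t₀ ht₀).sqrt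
    refine tendsto_of_tendsto_of_tendsto_of_le_of_le' tendsto_const_nhds h1
      (Eventually.of_forall fun t => dist_nonneg) ?_
    filter_upwards [self_mem_nhdsWithin] with t ht
    have hd := (hw.1 t ht).sub (hw.1 t₀ ht₀)
    have e1 := sqrt_sqOm_le_add (g := fun x => w x t) hd (hw.1 t₀ ht₀) (ae_of_all _ fun x => by
      simpa using abs_add_le (w x t - w x t₀) (w x t₀))
    have e2 := sqrt_sqOm_le_add (g := fun x => w x t₀) hd (hw.1 t ht) (ae_of_all _ fun x => by
      have := abs_sub (w x t) (w x t - w x t₀)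
      rw [sub_sub_cancel] at this
      linarith)
    rw [Real.dist_eq, abs_le]
    constructor <;> linarith
  refine (h.pow 2).congr fun t _ => ?_
  exact (Real.sq_sqrt (sqOm_nonneg _ _ _)).symm

section Energy

variable {a b T : ℝ} {f f' u0 u0x u0t Θ0 : ℝ → ℝ} {u ut ux Θ Θx : ℝ → ℝ → ℝ}

lemma ae_slice_of_ae_prod {p : ℝ × ℝ → Prop}
    (h : ∀ᵐ z ∂volume.restrict (Ioo a b ×ˢ Ioo 0 T), p z) :
    ∀ᵐ t ∂volume.restrict (Ioo 0 T), ∀ᵐ x ∂volume.restrict (Ioo a b), p (x, t) := by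
  rw [restrict_Ioo_prod] at h
  exact Measure.ae_ae_of_ae_prod (Measure.measurePreserving_swap.quasiMeasurePreserving.ae h)

lemma IsWeakSol.ae_sliceReg (hs : IsWeakSol a b T f f' u0 u0t Θ0 u ut ux Θ Θx)
    (hr : RegT a b T u ut ux Θ Θx) :
    ∀ᵐ s ∂volume.restrict (Ioo 0 T),
      SliceReg a b f f' (fun x => ut x s) (fun x => Θ x s) (fun x => Θx x s) := by
  filter_upwards [ae_restrict_mem measurableSet_Ioo, integrableOn_slice_ae hs.Θx_int,
    integrableOn_slice_ae (F := fun x t => Θx x t ^ 2) hr.Θx_sq_int, hs.Θ_W,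
    ae_slice_of_ae_prod hs.Θ_nonneg,
    integrableOn_slice_ae (F := fun x t => f' (Θ x t) * Θx x t) hs.g1_int,
    integrableOn_slice_ae (F := fun x t => f' (Θ x t) * Θx x t * ut x t) hs.g2_int,
    integrableOn_slice_ae (F := fun x t => f (Θ x t) * ut x t) hs.g3_int]
    with s h0 h1 h2 h3 h4 h5 h6 h7
  exact ⟨hr.ut_cont.1 s (Ioo_subset_Icc_self h0), hr.Θ_cont.1 s (Ioo_subset_Icc_self h0),
    ⟨h1.1, h2⟩, h3, h4, h5, h6, h7⟩

variable {v0 v0x v0t Φ0 : ℝ → ℝ} {v vt vx Φ Φx : ℝ → ℝ → ℝ}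

/-- The energy identity of a single mode for the difference of two solutions. -/
lemma IsWeakSol.mode_energy (hab : a < b) (hT : 0 < T)
    (hd₁ : DataI a b u0 u0x u0t Θ0) (hs₁ : IsWeakSol a b T f f' u0 u0t Θ0 u ut ux Θ Θx)
    (hr₁ : RegT a b T u ut ux Θ Θx)
    (hd₂ : DataI a b v0 v0x v0t Φ0) (hs₂ : IsWeakSol a b T f f' v0 v0t Φ0 v vt vx Φ Φx)
    (hr₂ : RegT a b T v vt vx Φ Φx) (n : ℕ) :
    IsPrimitiveOn T ((∫ x in Ioo a b, (u0t x - v0t x) * sinMode a b n x) ^ 2 +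
        (∫ x in Ioo a b, (u0x x - v0x x) * cosMode a b n x) ^ 2 +
        (∫ x in Ioo a b, (Θ0 x - Φ0 x) * cosMode a b n x) ^ 2)
      (fun s => 2 * (-((∫ x in Ioo a b, (f' (Θ x s) * Θx x s - f' (Φ x s) * Φx x s) *
            sinMode a b n x) * ∫ x in Ioo a b, (ut x s - vt x s) * sinMode a b n x) +
          (∫ x in Ioo a b, (Θ x s - Φ x s) * cosMode a b n x) *
            (∫ x in Ioo a b, (f' (Θ x s) * Θx x s * ut x s - f' (Φ x s) * Φx x s * vt x s) *
              cosMode a b n x) +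
          (∫ x in Ioo a b, (Θx x s - Φx x s) * sinMode a b n x) *
            ∫ x in Ioo a b, (f (Θ x s) * ut x s - f (Φ x s) * vt x s) * sinMode a b n x) -
        2 * (∫ x in Ioo a b, (Θx x s - Φx x s) * sinMode a b n x) ^ 2)
      (fun t => (∫ x in Ioo a b, (ut x t - vt x t) * sinMode a b n x) ^ 2 +
        (∫ x in Ioo a b, (ux x t - vx x t) * cosMode a b n x) ^ 2 +
        (∫ x in Ioo a b, (Θ x t - Φ x t) * cosMode a b n x) ^ 2) := by
  have hcc := (contDiff_cosMode a b n).continuous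
  have hsc := (contDiff_sinMode a b n).continuous
  obtain ⟨hu₁, hv₁⟩ := hs₁.integral_mul_sinMode hab hT hd₁ hr₁ n
  obtain ⟨hu₂, hv₂⟩ := hs₂.integral_mul_sinMode hab hT hd₂ hr₂ n
  have hθ := (hs₁.integral_mul_cosMode hT hr₁ n).sub (hs₂.integral_mul_cosMode hT hr₂ n)
  have hsum := (((hv₁.sub hv₂).sq hT).add (((hu₁.sub hu₂).const_mul (modeFreq a b n)).sq hT)).add
    (hθ.sq hT)
  refine hsum.congr ?_ (fun t ht => ?_) ?_
  · filter_upwards [ae_restrict_mem measurableSet_Ioo, hs₁.ae_sliceReg hr₁, hs₂.ae_sliceReg hr₂]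
      with s hs h₁ h₂
    have hs' := Ioo_subset_Icc_self hs
    rw [integral_sub_mul h₁.g1_int h₂.g1_int hsc,
      integral_sub_mul h₁.g2_int h₂.g2_int hcc, integral_sub_mul h₁.g3_int h₂.g3_int hsc,
      integral_sub_mul h₁.v_L2.integrableOn h₂.v_L2.integrableOn hsc,
      integral_sub_mul h₁.θ_L2.integrableOn h₂.θ_L2.integrableOn hcc,
      integral_sub_mul h₁.θx_L2.integrableOn h₂.θx_L2.integrableOn hsc,
      (hr₁.u_W0 s hs').integral_mul_cosMode n, (hr₂.u_W0 s hs').integral_mul_cosMode n,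
      h₁.weak.integral_mul_sinMode hab h₁.θ_L2.integrableOn h₁.θx_L2.integrableOn n,
      h₂.weak.integral_mul_sinMode hab h₂.θ_L2.integrableOn h₂.θx_L2.integrableOn n]
    ring
  · rw [integral_sub_mul (hr₁.ut_cont.1 t ht).integrableOn (hr₂.ut_cont.1 t ht).integrableOn hsc,
      integral_sub_mul (hr₁.ux_cont.1 t ht).integrableOn (hr₂.ux_cont.1 t ht).integrableOn hcc,
      integral_sub_mul (hr₁.Θ_cont.1 t ht).integrableOn (hr₂.Θ_cont.1 t ht).integrableOn hcc,
      (hr₁.u_W0 t ht).integral_mul_cosMode n, (hr₂.u_W0 t ht).integral_mul_cosMode n]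
    ring
  · rw [integral_sub_mul hd₁.u0t_L2.integrableOn hd₂.u0t_L2.integrableOn hsc,
      integral_sub_mul hd₁.u0x_L2.integrableOn hd₂.u0x_L2.integrableOn hcc,
      integral_sub_mul hd₁.Θ0_L2.integrableOn hd₂.Θ0_L2.integrableOn hcc,
      hd₁.u0_W0.integral_mul_cosMode n, hd₂.u0_W0.integral_mul_cosMode n]
    ring

end Energy

lemma IntegrableOn.sq_sub_of_Ioo {a b T : ℝ} {F G : ℝ → ℝ → ℝ}
    (hF : IntegrableOn (fun p : ℝ × ℝ => F p.1 p.2) (Ioo a b ×ˢ Ioo 0 T))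
    (hF2 : IntegrableOn (fun p : ℝ × ℝ => F p.1 p.2 ^ 2) (Ioo a b ×ˢ Ioo 0 T))
    (hG : IntegrableOn (fun p : ℝ × ℝ => G p.1 p.2) (Ioo a b ×ˢ Ioo 0 T))
    (hG2 : IntegrableOn (fun p : ℝ × ℝ => G p.1 p.2 ^ 2) (Ioo a b ×ˢ Ioo 0 T)) :
    IntegrableOn (fun p : ℝ × ℝ => (F p.1 p.2 - G p.1 p.2) ^ 2) (Ioo a b ×ˢ Ioo 0 T) :=
  (((memLp_two_iff_integrable_sq hF.1).mpr hF2).sub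
    ((memLp_two_iff_integrable_sq hG.1).mpr hG2)).integrable_sq

/-- The energy of a state with velocity `p`, strain `q` and temperature `r`. -/
def stateEnergy (a b : ℝ) (p q r : ℝ → ℝ) : ℝ := sqOm a b p + sqOm a b q + sqOm a b r

lemma stateEnergy_nonneg (a b : ℝ) (p q r : ℝ → ℝ) : 0 ≤ stateEnergy a b p q r :=
  add_nonneg (add_nonneg (sqOm_nonneg _ _ _) (sqOm_nonneg _ _ _)) (sqOm_nonneg _ _ _)

lemma hasSum_stateEnergy {a b : ℝ} (hab : a < b) {p q r : ℝ → ℝ} (hp : MemL2 a b p)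
    (hq : MemL2 a b q) (hr : MemL2 a b r) :
    HasSum (fun n => modeWeight a b n * ((∫ x in Ioo a b, p x * sinMode a b n x) ^ 2 +
      (∫ x in Ioo a b, q x * cosMode a b n x) ^ 2 +
      (∫ x in Ioo a b, r x * cosMode a b n x) ^ 2)) (stateEnergy a b p q r) := by
  simp only [mul_add]
  exact ((hasSum_sinMode hab hp).add (hasSum_cosMode hab hq)).add (hasSum_cosMode hab hr)

section Energy

variable {a b T M A : ℝ} {f f' u0 u0x u0t Θ0 : ℝ → ℝ} {u ut ux Θ Θx : ℝ → ℝ → ℝ}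
  {v0 v0x v0t Φ0 : ℝ → ℝ} {v vt vx Φ Φx : ℝ → ℝ → ℝ}

lemma RegT.continuousOn_stateEnergy (hr₁ : RegT a b T u ut ux Θ Θx)
    (hr₂ : RegT a b T v vt vx Φ Φx) :
    ContinuousOn (fun t => stateEnergy a b (fun x => ut x t - vt x t) (fun x => ux x t - vx x t)
      (fun x => Θ x t - Φ x t)) (Icc 0 T) :=
  ((hr₁.ut_cont.sub hr₂.ut_cont).continuousOn_sqOm.add
    (hr₁.ux_cont.sub hr₂.ux_cont).continuousOn_sqOm).add
    (hr₁.Θ_cont.sub hr₂.Θ_cont).continuousOn_sqOm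

/-- The energy inequality for the difference of two solutions. -/
lemma IsWeakSol.energy_le (hab : a < b) (hT : 0 < T) (hf : NonlinBound f f' M) (hA : 0 ≤ A)
    (hd₁ : DataI a b u0 u0x u0t Θ0) (hs₁ : IsWeakSol a b T f f' u0 u0t Θ0 u ut ux Θ Θx)
    (hr₁ : RegT a b T u ut ux Θ Θx)
    (hd₂ : DataI a b v0 v0x v0t Φ0) (hs₂ : IsWeakSol a b T f f' v0 v0t Φ0 v vt vx Φ Φx)
    (hr₂ : RegT a b T v vt vx Φ Φx) {t : ℝ} (ht : t ∈ Icc 0 T)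
    (hv : ∀ s ∈ Ioo 0 t, √(sqOm a b (fun x => ut x s)) ≤ A)
    (hθ : ∀ s ∈ Ioo 0 t, √(sqOm a b (fun x => Φ x s)) ≤ A) :
    stateEnergy a b (fun x => ut x t - vt x t) (fun x => ux x t - vx x t)
        (fun x => Θ x t - Φ x t) +
      ∫ s in (0 : ℝ)..t, sqOm a b (fun x => Θx x s - Φx x s) ≤
    stateEnergy a b (fun x => u0t x - v0t x) (fun x => u0x x - v0x x) (fun x => Θ0 x - Φ0 x) +
      ∫ s in (0 : ℝ)..t, 2 * gronwallCoeff (b - a)⁻¹ M A * (1 + sqOm a b (fun x => Φx x s)) *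
        stateEnergy a b (fun x => ut x s - vt x s) (fun x => ux x s - vx x s)
          (fun x => Θ x s - Φ x s) := by
  set E : ℝ → ℝ := fun s => stateEnergy a b (fun x => ut x s - vt x s) (fun x => ux x s - vx x s)
    (fun x => Θ x s - Φ x s) with hE
  set D : ℝ → ℝ := fun s => sqOm a b (fun x => Θx x s - Φx x s) with hD
  set κ : ℝ → ℝ := fun s => 2 * gronwallCoeff (b - a)⁻¹ M A * (1 + sqOm a b (fun x => Φx x s))
    with hκ
  set E0 := stateEnergy a b (fun x => u0t x - v0t x) (fun x => u0x x - v0x x)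
    (fun x => Θ0 x - Φ0 x) with hE0
  set q : ℕ → ℝ → ℝ := fun n s => ∫ x in Ioo a b, (Θx x s - Φx x s) * sinMode a b n x with hq
  have hsub : Ioo 0 t ⊆ Ioo 0 T := Ioo_subset_Ioo_right ht.2
  have hC := gronwallCoeff_nonneg (K := (b - a)⁻¹) (inv_nonneg.mpr (by linarith)) hf.nonneg hA
  have hEc : ContinuousOn E (Icc 0 T) := hr₁.continuousOn_stateEnergy hr₂
  have hDi : IntegrableOn D (Ioo 0 T) :=
    integrableOn_integral_slice (F := fun x t => (Θx x t - Φx x t) ^ 2)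
      (IntegrableOn.sq_sub_of_Ioo hs₁.Θx_int hr₁.Θx_sq_int hs₂.Θx_int hr₂.Θx_sq_int)
  have hhi : IntegrableOn (fun s => sqOm a b (fun x => Φx x s)) (Ioo 0 T) :=
    integrableOn_integral_slice (F := fun x t => Φx x t ^ 2) hr₂.Θx_sq_int
  have hκi : IntegrableOn κ (Ioo 0 T) := by
    have h1 : IntegrableOn (fun _ : ℝ => (1 : ℝ)) (Ioo 0 T) := integrableOn_const (by simp)
    exact Integrable.const_mul (h1.add hhi) _
  have hκE : IntegrableOn (fun s => κ s * E s) (Ioo 0 T) :=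
    (IntegrableOn.mul_continuousOn ((integrableOn_Icc_iff_integrableOn_Ioo).mpr hκi) hEc
      isCompact_Icc).mono_set Ioo_subset_Icc_self
  have hqi : ∀ n, IntegrableOn (q n) (Ioo 0 T) := fun n =>
    integrableOn_mul_slice (F := fun x s => Θx x s - Φx x s) (hs₁.Θx_int.sub hs₂.Θx_int)
      (contDiff_sinMode a b n).continuous
  have hslice : ∀ᵐ s ∂volume.restrict (Ioo 0 t), s ∈ Ioo 0 t ∧
      SliceReg a b f f' (fun x => ut x s) (fun x => Θ x s) (fun x => Θx x s) ∧
      SliceReg a b f f' (fun x => vt x s) (fun x => Φ x s) (fun x => Φx x s) := by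
    filter_upwards [ae_restrict_mem measurableSet_Ioo,
      ae_restrict_of_ae_restrict_of_subset hsub (hs₁.ae_sliceReg hr₁),
      ae_restrict_of_ae_restrict_of_subset hsub (hs₂.ae_sliceReg hr₂)] with s h0 h1 h2
    exact ⟨h0, h1, h2⟩
  have hDN : ∀ N, AEStronglyMeasurable
      (fun s => ∑ n ∈ Finset.range N, modeWeight a b n * q n s ^ 2)
      (volume.restrict (Ioo 0 t)) := fun N =>
    Finset.aestronglyMeasurable_fun_sum _ fun n _ =>
      (((hqi n).mono_set hsub).1.pow 2).const_mul _
  have hDN_le : ∀ N, ∀ᵐ s ∂volume.restrict (Ioo 0 t),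
      ‖∑ n ∈ Finset.range N, modeWeight a b n * q n s ^ 2‖ ≤ D s := by
    intro N
    filter_upwards [hslice] with s ⟨_, h1, h2⟩
    rw [Real.norm_of_nonneg (Finset.sum_nonneg fun n _ =>
      mul_nonneg (modeWeight_pos hab n).le (sq_nonneg _))]
    exact sum_sinMode_le hab N (h1.θx_L2.sub h2.θx_L2)
  have hDNi : ∀ N, IntegrableOn (fun s => ∑ n ∈ Finset.range N, modeWeight a b n * q n s ^ 2)
      (Ioo 0 t) := fun N => (hDi.mono_set hsub).mono' (hDN N) (hDN_le N)
  have hlim : Tendsto (fun N => ∫ s in Ioo 0 t,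
      ∑ n ∈ Finset.range N, modeWeight a b n * q n s ^ 2) atTop (nhds (∫ s in Ioo 0 t, D s)) := by
    refine tendsto_integral_of_dominated_convergence D hDN (hDi.mono_set hsub) hDN_le ?_
    filter_upwards [hslice] with s ⟨_, h1, h2⟩
    exact (hasSum_sinMode hab (h1.θx_L2.sub h2.θx_L2)).tendsto_sum_nat
  have hElim := (hasSum_stateEnergy hab ((hr₁.ut_cont.1 t ht).sub (hr₂.ut_cont.1 t ht))
    ((hr₁.ux_cont.1 t ht).sub (hr₂.ux_cont.1 t ht))
    ((hr₁.Θ_cont.1 t ht).sub (hr₂.Θ_cont.1 t ht))).tendsto_sum_nat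
  rw [intervalIntegral.integral_of_le ht.1, intervalIntegral.integral_of_le ht.1,
    integral_Ioc_eq_integral_Ioo, integral_Ioc_eq_integral_Ioo]
  have hH : IntegrableOn (fun s => D s + κ s * E s) (Ioo 0 t) :=
    (hDi.mono_set hsub).add (hκE.mono_set hsub)
  have key := le_of_tendsto_of_tendsto' hElim
    ((hlim.const_mul 2).const_sub (E0 + ∫ s in Ioo 0 t, (D s + κ s * E s))) (fun N => by
      have h1 := (IsPrimitiveOn.sum (s := Finset.range N) fun n =>
        (hs₁.mode_energy hab hT hd₁ hr₁ hd₂ hs₂ hr₂ n).const_mul (modeWeight a b n))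
      refine (h1.2 t ht).trans_le ?_
      have h2 := sum_le_hasSum (Finset.range N) (fun n _ => mul_nonneg (modeWeight_pos hab n).le
        (by positivity)) (hasSum_stateEnergy hab (hd₁.u0t_L2.sub hd₂.u0t_L2)
          (hd₁.u0x_L2.sub hd₂.u0x_L2) (hd₁.Θ0_L2.sub hd₂.Θ0_L2))
      rw [add_sub_assoc, ← integral_const_mul, ← integral_sub hH ((hDNi N).const_mul 2),
        intervalIntegral.integral_of_le ht.1, integral_Ioc_eq_integral_Ioo]
      refine add_le_add h2 (setIntegral_mono_ae_restrict (h1.1.mono_set hsub)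
        (hH.sub ((hDNi N).const_mul 2)) ?_)
      filter_upwards [hslice] with s ⟨h0, h3, h4⟩
      have h5 := h3.sum_le hab hf hA h4 (hv s h0)
        (hθ s h0) N
      have h6 : κ s * (sqOm a b (fun x => Θ x s - Φ x s) + sqOm a b (fun x => ut x s - vt x s)) ≤
          κ s * E s := by
        refine mul_le_mul_of_nonneg_left ?_ (mul_nonneg (by positivity)
          (by linarith [sqOm_nonneg a b (fun x => Φx x s)]))
        simp only [hE, stateEnergy]
        linarith [sqOm_nonneg a b (fun x => ux x s - vx x s)]
      have h7 := mul_le_mul_of_nonneg_left h5 zero_le_two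
      rw [Finset.mul_sum] at h7 ⊢
      simp only [hκ] at h6
      have e : ∀ (w B Q : ℝ), w * (2 * B - 2 * Q) = 2 * (w * B) - 2 * (w * Q) := fun w B Q => by
        ring
      simp only [e, Finset.sum_sub_distrib]
      simp only [hD, hq]
      linarith)
  have h8 : ∫ s in Ioo 0 t, (D s + κ s * E s) =
      (∫ s in Ioo 0 t, D s) + ∫ s in Ioo 0 t, κ s * E s :=
    integral_add (hDi.mono_set hsub) (hκE.mono_set hsub)
  rw [h8] at key
  linarith

end Energy

section Stability

variable {a b T M : ℝ} {f f' : ℝ → ℝ} {v0 v0x v0t Φ0 : ℝ → ℝ} {v vt vx Φ Φx : ℝ → ℝ → ℝ}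

/-- Stability of a given solution with respect to perturbations of small initial energy. -/
lemma IsWeakSol.exists_stability (hab : a < b) (hT : 0 < T) (hf : NonlinBound f f' M)
    (hd₂ : DataI a b v0 v0x v0t Φ0) (hs₂ : IsWeakSol a b T f f' v0 v0t Φ0 v vt vx Φ Φx)
    (hr₂ : RegT a b T v vt vx Φ Φx) :
    ∃ K : ℝ, ∀ (u0 u0x u0t Θ0 : ℝ → ℝ) (u ut ux Θ Θx : ℝ → ℝ → ℝ), DataI a b u0 u0x u0t Θ0 →
      IsWeakSol a b T f f' u0 u0t Θ0 u ut ux Θ Θx → RegT a b T u ut ux Θ Θx →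
      stateEnergy a b (fun x => u0t x - v0t x) (fun x => u0x x - v0x x)
        (fun x => Θ0 x - Φ0 x) * K < 1 →
      ∀ t ∈ Icc 0 T,
        stateEnergy a b (fun x => ut x t - vt x t) (fun x => ux x t - vx x t)
          (fun x => Θ x t - Φ x t) +
        ∫ s in (0 : ℝ)..t, sqOm a b (fun x => Θx x s - Φx x s) ≤
        stateEnergy a b (fun x => u0t x - v0t x) (fun x => u0x x - v0x x)
          (fun x => Θ0 x - Φ0 x) * K := by
  obtain ⟨A₁, hA₁⟩ := isCompact_Icc.exists_bound_of_continuousOn hr₂.ut_cont.continuousOn_sqOm.sqrt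
  obtain ⟨A₂, hA₂⟩ := isCompact_Icc.exists_bound_of_continuousOn hr₂.Θ_cont.continuousOn_sqOm.sqrt
  simp only [Real.norm_of_nonneg (Real.sqrt_nonneg _)] at hA₁ hA₂
  have h0T : (0 : ℝ) ∈ Icc 0 T := ⟨le_rfl, hT.le⟩
  have hA₁0 : 0 ≤ A₁ := (Real.sqrt_nonneg _).trans (hA₁ 0 h0T)
  have hA₂0 : 0 ≤ A₂ := (Real.sqrt_nonneg _).trans (hA₂ 0 h0T)
  set A := A₁ + A₂ + 1 with hA
  have hA0 : 0 ≤ A := by positivity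
  have hC := gronwallCoeff_nonneg (K := (b - a)⁻¹) (inv_nonneg.mpr (by linarith)) hf.nonneg hA0
  set κ : ℝ → ℝ := fun s => 2 * gronwallCoeff (b - a)⁻¹ M A * (1 + sqOm a b (fun x => Φx x s))
    with hκ
  have hκ0 : ∀ s, 0 ≤ κ s := fun s =>
    mul_nonneg (by positivity) (by linarith [sqOm_nonneg a b (fun x => Φx x s)])
  have hκi : IntervalIntegrable κ volume 0 T := by
    rw [intervalIntegrable_iff_integrableOn_Ioo_of_le hT.le]
    have h1 : IntegrableOn (fun _ : ℝ => (1 : ℝ)) (Ioo 0 T) := integrableOn_const (by simp)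
    exact Integrable.const_mul
      (h1.add (integrableOn_integral_slice (F := fun x t => Φx x t ^ 2) hr₂.Θx_sq_int)) _
  refine ⟨Real.exp (∫ s in (0 : ℝ)..T, κ s), ?_⟩
  intro u0 u0x u0t Θ0 u ut ux Θ Θx hd₁ hs₁ hr₁ hsmall
  set E : ℝ → ℝ := fun s => stateEnergy a b (fun x => ut x s - vt x s) (fun x => ux x s - vx x s)
    (fun x => Θ x s - Φ x s) with hE
  set D : ℝ → ℝ := fun s => sqOm a b (fun x => Θx x s - Φx x s) with hD
  set E0 := stateEnergy a b (fun x => u0t x - v0t x) (fun x => u0x x - v0x x)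
    (fun x => Θ0 x - Φ0 x) with hE0
  have hE00 : 0 ≤ E0 := stateEnergy_nonneg _ _ _ _ _
  have hEc : ContinuousOn E (Icc 0 T) := hr₁.continuousOn_stateEnergy hr₂
  have hDint : ∀ t ∈ Icc 0 T, 0 ≤ ∫ s in (0 : ℝ)..t, D s := fun t ht =>
    intervalIntegral.integral_nonneg ht.1 fun s _ => sqOm_nonneg _ _ _
  have main : ∀ t ∈ Icc 0 T, (∀ s ∈ Ioo 0 t, E s ≤ 1) →
      E t + ∫ s in (0 : ℝ)..t, D s ≤ E0 * Real.exp (∫ s in (0 : ℝ)..T, κ s) := by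
    intro t ht hbd
    have henergy : ∀ s ∈ Icc 0 t, E s + ∫ r in (0 : ℝ)..s, D r ≤
        E0 + ∫ r in (0 : ℝ)..s, κ r * E r := by
      intro s hs
      refine hs₁.energy_le hab hT hf hA0 hd₁ hr₁ hd₂ hs₂ hr₂ ⟨hs.1, hs.2.trans ht.2⟩ ?_ ?_
      · intro r hr
        have hrT : r ∈ Icc 0 T := ⟨hr.1.le, (hr.2.le.trans hs.2).trans ht.2⟩
        have h1 := sqrt_sqOm_le_add (g := fun x => ut x r)
          ((hr₁.ut_cont.1 r hrT).sub (hr₂.ut_cont.1 r hrT)) (hr₂.ut_cont.1 r hrT)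
          (ae_of_all _ fun x => by simpa using abs_add_le (ut x r - vt x r) (vt x r))
        have h2 : √(sqOm a b (fun x => ut x r - vt x r)) ≤ 1 := by
          refine Real.sqrt_le_one.mpr (le_trans ?_ (hbd r ⟨hr.1, hr.2.trans_le hs.2⟩))
          simp only [hE, stateEnergy]
          linarith [sqOm_nonneg a b (fun x => ux x r - vx x r),
            sqOm_nonneg a b (fun x => Θ x r - Φ x r)]
        linarith [hA₁ r hrT]
      · intro r hr
        linarith [hA₂ r ⟨hr.1.le, (hr.2.le.trans hs.2).trans ht.2⟩]
    have hg := gronwall_integral hκi hκ0 hEc ht (y := E0) fun s hs => by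
      linarith [henergy s hs, hDint s ⟨hs.1, hs.2.trans ht.2⟩]
    refine (henergy t ⟨ht.1, le_rfl⟩).trans (hg.trans ?_)
    gcongr
    exact intervalIntegral.integral_mono_interval le_rfl ht.1 ht.2 (ae_of_all _ hκ0) hκi
  have hlt : ∀ t ∈ Icc 0 T, E t < 1 := by
    by_contra! hcon
    obtain ⟨t₀, ht₀, h1⟩ := hcon
    have hcl : IsClosed (Icc 0 T ∩ E ⁻¹' Ici 1) := hEc.preimage_isClosed_of_isClosed isClosed_Icc
      isClosed_Ici
    obtain ⟨t₁, ht₁, hmin⟩ := (isCompact_Icc.of_isClosed_subset hcl inter_subset_left).exists_isLeast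
      ⟨t₀, ht₀, h1⟩
    have h2 := main t₁ ht₁.1 fun s hs => by
      by_contra! h3
      exact absurd (hmin ⟨⟨hs.1.le, hs.2.le.trans ht₁.1.2⟩, h3.le⟩) (not_le.mpr hs.2)
    have h3 : 1 ≤ E t₁ := ht₁.2
    linarith [hDint t₁ ht₁.1]
  exact fun t ht => main t ht fun s hs => (hlt s ⟨hs.1.le, hs.2.le.trans ht.2⟩).le

end Stability

lemma WeakDerivZ.sub {a b : ℝ} {g g' h h' : ℝ → ℝ} (hg : WeakDerivZ a b g g')
    (hh : WeakDerivZ a b h h') (ig : IntegrableOn g (Ioo a b)) (ig' : IntegrableOn g' (Ioo a b))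
    (ih : IntegrableOn h (Ioo a b)) (ih' : IntegrableOn h' (Ioo a b)) :
    WeakDerivZ a b (fun x => g x - h x) (fun x => g' x - h' x) := by
  intro ψ hψ
  rw [integral_sub_mul ig ih hψ.smooth_deriv.continuous, integral_sub_mul ig' ih' hψ.continuous,
    hg ψ hψ, hh ψ hψ]
  ring

/-- The Poincaré inequality. -/
lemma WeakDerivZ.sqOm_le {a b : ℝ} (hab : a < b) {g g' : ℝ → ℝ} (h : WeakDerivZ a b g g')
    (hg : MemL2 a b g) (hg' : MemL2 a b g') :
    sqOm a b g ≤ ((b - a) / Real.pi) ^ 2 * sqOm a b g' := by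
  refine hasSum_le (fun n => ?_) (hasSum_sinMode hab hg)
    ((hasSum_cosMode hab hg').mul_left (((b - a) / Real.pi) ^ 2))
  rw [h.integral_mul_cosMode n, mul_left_comm]
  refine mul_le_mul_of_nonneg_left ?_ (modeWeight_pos hab n).le
  rcases Nat.eq_zero_or_pos n with rfl | hn
  · simp [sinMode_zero]
  · have hL : b - a ≠ 0 := by linarith
    have hpi := Real.pi_ne_zero
    have e : ((b - a) / Real.pi) ^ 2 * (modeFreq a b n * ∫ x in Ioo a b, g x * sinMode a b n x) ^ 2
        = (n : ℝ) ^ 2 * (∫ x in Ioo a b, g x * sinMode a b n x) ^ 2 := by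
      rw [modeFreq]
      field_simp
    rw [e]
    have h1 : (1 : ℝ) ≤ (n : ℝ) ^ 2 := one_le_pow₀ (by exact_mod_cast hn)
    exact le_mul_of_one_le_left (sq_nonneg _) h1

/-- Proposition 1.2: continuous dependence of the solution on the data. -/
theorem statement1
    (a b : ℝ) (hab : a < b)
    (f f' f'' : ℝ → ℝ) (hf : HypF f f' f'')
    (u0 u0x u0t Θ0 : ℝ → ℝ) (hdata : DataI a b u0 u0x u0t Θ0)
    (u0s u0xs u0ts Θ0s : ℕ → ℝ → ℝ)
    (hdatas : ∀ k, DataI a b (u0s k) (u0xs k) (u0ts k) (Θ0s k))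
    (hconv_u0 : Tendsto (fun k => sqOm a b (fun x => u0s k x - u0 x)
        + sqOm a b (fun x => u0xs k x - u0x x)) atTop (nhds 0))
    (hconv_u0t : Tendsto (fun k => sqOm a b (fun x => u0ts k x - u0t x)) atTop (nhds 0))
    (hconv_Θ0 : Tendsto (fun k => sqOm a b (fun x => Θ0s k x - Θ0 x)) atTop (nhds 0))
    (u ut ux Θ Θx : ℝ → ℝ → ℝ)
    (hsol : ∀ T > (0 : ℝ), IsWeakSol a b T f f' u0 u0t Θ0 u ut ux Θ Θx)
    (hreg : ∀ T > (0 : ℝ), RegT a b T u ut ux Θ Θx)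
    (us uts uxs Θs Θxs : ℕ → ℝ → ℝ → ℝ)
    (hsols : ∀ k, ∀ T > (0 : ℝ),
      IsWeakSol a b T f f' (u0s k) (u0ts k) (Θ0s k) (us k) (uts k) (uxs k) (Θs k) (Θxs k))
    (hregs : ∀ k, ∀ T > (0 : ℝ), RegT a b T (us k) (uts k) (uxs k) (Θs k) (Θxs k)) :
    ∀ T > (0 : ℝ),
      (∀ η > (0 : ℝ), ∃ N : ℕ, ∀ k ≥ N, ∀ t ∈ Icc (0 : ℝ) T,
        sqOm a b (fun x => us k x t - u x t) ≤ η ∧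
        sqOm a b (fun x => uxs k x t - ux x t) ≤ η ∧
        sqOm a b (fun x => uts k x t - ut x t) ≤ η ∧
        sqOm a b (fun x => Θs k x t - Θ x t) ≤ η) ∧
      Tendsto (fun k => intOmT a b T (fun x t => (Θxs k x t - Θx x t) ^ 2)) atTop (nhds 0) := by
  intro T hT
  obtain ⟨M, hM⟩ := hf.exists_nonlinBound
  obtain ⟨K, hK⟩ := (hsol T hT).exists_stability hab hT hM hdata (hreg T hT)
  set e : ℕ → ℝ := fun k => stateEnergy a b (fun x => u0ts k x - u0t x)
    (fun x => u0xs k x - u0x x) (fun x => Θ0s k x - Θ0 x) * K with he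
  have hlim : Tendsto e atTop (nhds 0) := by
    have hx : Tendsto (fun k => sqOm a b (fun x => u0xs k x - u0x x)) atTop (nhds 0) :=
      squeeze_zero (fun k => sqOm_nonneg _ _ _)
        (fun k => le_add_of_nonneg_left (sqOm_nonneg _ _ _)) hconv_u0
    simpa only [he, stateEnergy, add_zero, zero_mul] using ((hconv_u0t.add hx).add hconv_Θ0).mul_const K
  have hstab : ∀ᶠ k in atTop, ∀ t ∈ Icc 0 T,
      stateEnergy a b (fun x => uts k x t - ut x t) (fun x => uxs k x t - ux x t)
        (fun x => Θs k x t - Θ x t) +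
      ∫ s in (0 : ℝ)..t, sqOm a b (fun x => Θxs k x s - Θx x s) ≤ e k := by
    filter_upwards [hlim.eventually_lt_const one_pos] with k hk
    exact hK _ _ _ _ _ _ _ _ _ (hdatas k) (hsols k T hT) (hregs k T hT) hk
  constructor
  · intro η hη
    set P := ((b - a) / Real.pi) ^ 2 with hP
    have hP0 : 0 ≤ P := sq_nonneg _
    have hlim' : Tendsto (fun k => P * e k) atTop (nhds 0) := by
      simpa only [mul_zero] using hlim.const_mul P
    obtain ⟨N, hN⟩ := eventually_atTop.mp ((hstab.and (hlim.eventually_le_const hη)).and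
      (hlim'.eventually_le_const hη))
    refine ⟨N, fun k hk t ht => ?_⟩
    obtain ⟨⟨h1, h2⟩, h3⟩ := hN k hk
    have h4 := h1 t ht
    have h5 : 0 ≤ ∫ s in (0 : ℝ)..t, sqOm a b (fun x => Θxs k x s - Θx x s) :=
      intervalIntegral.integral_nonneg ht.1 fun s _ => sqOm_nonneg _ _ _
    have h6 := sqOm_nonneg a b (fun x => uxs k x t - ux x t)
    have h7 := sqOm_nonneg a b (fun x => uts k x t - ut x t)
    have h8 := sqOm_nonneg a b (fun x => Θs k x t - Θ x t)
    rw [stateEnergy] at h4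
    have r₁ := hregs k T hT
    have r₂ := hreg T hT
    have h9 := ((r₁.u_W0 t ht).sub (r₂.u_W0 t ht) (r₁.u_cont.1 t ht).integrableOn
      (r₁.ux_cont.1 t ht).integrableOn (r₂.u_cont.1 t ht).integrableOn
      (r₂.ux_cont.1 t ht).integrableOn).sqOm_le hab
      ((r₁.u_cont.1 t ht).sub (r₂.u_cont.1 t ht)) ((r₁.ux_cont.1 t ht).sub (r₂.ux_cont.1 t ht))
    refine ⟨h9.trans (le_trans (mul_le_mul_of_nonneg_left ?_ hP0) h3), ?_, ?_, ?_⟩ <;> linarith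
  · have hint : ∀ k, IntegrableOn (fun p : ℝ × ℝ => (Θxs k p.1 p.2 - Θx p.1 p.2) ^ 2)
        (Ioo a b ×ˢ Ioo 0 T) := fun k =>
      IntegrableOn.sq_sub_of_Ioo (hsols k T hT).Θx_int (hregs k T hT).Θx_sq_int
        (hsol T hT).Θx_int (hreg T hT).Θx_sq_int
    refine squeeze_zero' (Eventually.of_forall fun k => integral_nonneg fun p => sq_nonneg _) ?_
      hlim
    filter_upwards [hstab] with k hk
    rw [intOmT_eq_integral_integral (F := fun x t => (Θxs k x t - Θx x t) ^ 2) (hint k)]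
    have h1 := hk T ⟨hT.le, le_rfl⟩
    rw [intervalIntegral.integral_of_le hT.le, integral_Ioc_eq_integral_Ioo] at h1
    exact (le_add_of_nonneg_left (stateEnergy_nonneg _ _ _ _ _)).trans h1
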